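/- Let ℓ, m be positive integers. If A ⊆ ℕ satisfies d_(A) + d̄(A) > 1, then there exist an infinite set B ⊆ ℕ and some t ∈ {0, 1, …, ℓ+m−1} such that {m·b₁ + ℓ·b₂ : b₁, b₂ ∈ B and b₁ ≤ b₂} + t ⊆ A. -/

import Mathlib

open Filter MeasureTheory Topology

open scoped Classical in
/-- Upper Banach density: `limsup` over window length `N` of the maximal count of
elements of `A` in a window of length `N`, divided by `N`. -/
noncomputable def upperBanachDensity (A : Set ℕ) : ℝ :=
  Filter.limsup
    (fun N : ℕ => ⨆ M : ℕ, (((Finset.Ico M (M + N)).filter (· ∈ A)).card : ℝ) / N)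
    Filter.atTop

open scoped Classical in
/-- Natural upper density of a set of naturals. -/
noncomputable def upperDensity (A : Set ℕ) : ℝ :=
  Filter.limsup (fun N : ℕ => (((Finset.Icc 1 N).filter (· ∈ A)).card : ℝ) / N)
    Filter.atTop

open scoped Classical in
/-- Natural lower density of a set of naturals. -/
noncomputable def lowerDensity (A : Set ℕ) : ℝ :=
  Filter.liminf (fun N : ℕ => (((Finset.Icc 1 N).filter (· ∈ A)).card : ℝ) / N)
    Filter.atTop


namespace SumsetAux

noncomputable instance instMeasCircle : MeasurableSpace Circle := borel _
instance instBorelCircle : BorelSpace Circle := ⟨rfl⟩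

open scoped Classical in
/-- Averages of characters. -/
lemma circ_avg (w : Circle) :
    Tendsto (fun N : ℕ => (N : ℂ)⁻¹ * ∑ n ∈ Finset.range N, (w : ℂ) ^ n) atTop
      (𝓝 (if w = 1 then 1 else 0)) := by
  split_ifs with h
  · subst h
    simp only [Circle.coe_one, one_pow, Finset.sum_const, Finset.card_range, nsmul_eq_mul, mul_one]
    refine tendsto_const_nhds.congr' ?_
    filter_upwards [eventually_gt_atTop 0] with N hN
    rw [inv_mul_cancel₀]
    exact_mod_cast hN.ne'
  · have hw : (w : ℂ) ≠ 1 := fun h' => h (by ext; simpa using h')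
    have hw' : (w : ℂ) - 1 ≠ 0 := sub_ne_zero.2 hw
    rw [tendsto_zero_iff_norm_tendsto_zero]
    have hlim : Tendsto (fun N : ℕ => (N : ℝ)⁻¹ * (2 / ‖(w : ℂ) - 1‖)) atTop (𝓝 0) := by
      have := (tendsto_inv_atTop_nhds_zero_nat (𝕜 := ℝ)).mul_const (2 / ‖(w : ℂ) - 1‖)
      simpa using this
    refine squeeze_zero (fun _ => norm_nonneg _) (fun N => ?_) hlim
    rw [geom_sum_eq hw, norm_mul, norm_inv, norm_div, Complex.norm_natCast]
    gcongr
    calc ‖(w : ℂ) ^ N - 1‖ ≤ ‖(w : ℂ) ^ N‖ + ‖(1 : ℂ)‖ := norm_sub_le _ _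
      _ = 2 := by rw [norm_pow, Circle.norm_coe]; norm_num

/-- Haar probability measure on the circle -/
noncomputable def hc : Measure Circle := Measure.haarMeasure ⊤

instance : hc.IsMulLeftInvariant := by unfold hc; infer_instance
instance : IsProbabilityMeasure hc := ⟨by
  have := Measure.haarMeasure_self (G := Circle) (K₀ := ⊤)
  simpa [hc] using this⟩

lemma cont_int {X : Type*} [TopologicalSpace X] [CompactSpace X] [MeasurableSpace X] [BorelSpace X]
    (μ : Measure X) [IsFiniteMeasure μ] {f : X → ℂ} (hf : Continuous f) : Integrable f μ := by
  have := BoundedContinuousFunction.integrable μ (BoundedContinuousFunction.mkOfCompact ⟨f, hf⟩)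
  exact this

lemma cont_zpow (k : ℤ) : Continuous fun z : Circle => ((z ^ k : Circle) : ℂ) :=
  continuous_subtype_val.comp (continuous_zpow k)

lemma cont_int' {X : Type*} [TopologicalSpace X] [CompactSpace X] [MeasurableSpace X] [BorelSpace X]
    (μ : Measure X) [IsFiniteMeasure μ] {f : X → ℝ} (hf : Continuous f) : Integrable f μ := by
  have := BoundedContinuousFunction.integrable μ (BoundedContinuousFunction.mkOfCompact ⟨f, hf⟩)
  exact this

lemma hc_int (k : ℤ) : ∫ z : Circle, ((z ^ k : Circle) : ℂ) ∂hc = if k = 0 then 1 else 0 := by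
  split_ifs with h
  · simp [h]
  · obtain ⟨w, hw⟩ : ∃ w : Circle, w ^ k ≠ 1 := by
      refine ⟨Circle.exp (1 / k * (Real.pi)), ?_⟩
      rw [← Circle.exp_zsmul]
      have : (k : ℝ) ≠ 0 := by exact_mod_cast h
      have h2 : k • (1 / (k:ℝ) * Real.pi) = Real.pi := by
        rw [zsmul_eq_mul]; field_simp
      rw [h2]
      intro h3
      have := congrArg (fun c : Circle => (c : ℂ)) h3
      simp at this
      norm_num at this
    have h1 := integral_mul_left_eq_self (μ := hc) (fun z : Circle => ((z ^ k : Circle) : ℂ)) w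
    simp only [mul_zpow, Circle.coe_mul] at h1
    rw [integral_const_mul] at h1
    have hw' : ((w ^ k : Circle) : ℂ) - 1 ≠ 0 :=
      sub_ne_zero.2 (fun h' => hw (by ext; simpa using h'))
    have h4 : (((w ^ k : Circle) : ℂ) - 1) * ∫ z : Circle, ((z ^ k : Circle) : ℂ) ∂hc = 0 := by
      rw [sub_mul, h1, one_mul, sub_self]
    exact (mul_eq_zero.1 h4).resolve_left hw'

variable {H : Type*} [NormedAddCommGroup H] [InnerProductSpace ℂ H]

lemma inner_iter (U : H →ₗᵢ[ℂ] H) (f g : H) (n : ℕ) :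
    inner ℂ (U^[n] f) (U^[n] g) = inner ℂ f g := by
  induction n with
  | zero => rfl
  | succ n ih => rw [Function.iterate_succ_apply', Function.iterate_succ_apply', U.inner_map_map, ih]

lemma inner_iter' (U : H →ₗᵢ[ℂ] H) (f : H) (n h : ℕ) :
    inner ℂ (U^[n] f) (U^[n + h] f) = inner ℂ f (U^[h] f) := by
  rw [Function.iterate_add_apply, inner_iter]

/-- The approximating densities. -/
noncomputable def dens (U : H →ₗᵢ[ℂ] H) (f : H) (N : ℕ) (z : Circle) : ℝ :=
  (N : ℝ)⁻¹ * ‖∑ n ∈ Finset.range N, ((z ^ (-(n : ℤ)) : Circle) : ℂ) • U^[n] f‖ ^ 2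

lemma dens_cont (U : H →ₗᵢ[ℂ] H) (f : H) (N : ℕ) : Continuous (dens U f N) := by
  unfold dens
  exact continuous_const.mul ((continuous_finsetSum _ fun n _ =>
    (cont_zpow _).smul continuous_const).norm.pow 2)

lemma dens_nonneg (U : H →ₗᵢ[ℂ] H) (f : H) (N : ℕ) (z) : 0 ≤ dens U f N z := by
  unfold dens; positivity

lemma dens_eq (U : H →ₗᵢ[ℂ] H) (f : H) (N : ℕ) (z : Circle) :
    (dens U f N z : ℂ) = (N : ℂ)⁻¹ * ∑ n ∈ Finset.range N, ∑ k ∈ Finset.range N,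
      ((z ^ ((n : ℤ) - k) : Circle) : ℂ) * inner ℂ (U^[n] f) (U^[k] f) := by
  unfold dens
  simp only [Complex.ofReal_mul, Complex.ofReal_inv, Complex.ofReal_natCast, Complex.ofReal_pow]
  congr 1
  have := inner_self_eq_norm_sq_to_K (𝕜 := ℂ)
    (∑ n ∈ Finset.range N, ((z ^ (-(n : ℤ)) : Circle) : ℂ) • U^[n] f)
  erw [← this]
  rw [sum_inner]
  refine Finset.sum_congr rfl fun n _ => ?_
  rw [inner_sum]
  refine Finset.sum_congr rfl fun k _ => ?_
  rw [inner_smul_left, inner_smul_right, ← mul_assoc, ← Circle.coe_inv_eq_conj, ← Circle.coe_mul]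
  congr 3
  rw [← zpow_neg, ← zpow_add]; congr 1; ring

lemma dens_moment (U : H →ₗᵢ[ℂ] H) (f : H) (N h : ℕ) :
    ∫ z : Circle, (z : ℂ) ^ h * (dens U f N z : ℂ) ∂hc
      = (N : ℂ)⁻¹ * ((N - h : ℕ) : ℂ) * inner ℂ f (U^[h] f) := by
  have h1 : ∀ z : Circle, (z : ℂ) ^ h * (dens U f N z : ℂ)
      = (N : ℂ)⁻¹ * ∑ n ∈ Finset.range N, ∑ k ∈ Finset.range N,
      ((z ^ ((n : ℤ) + h - k) : Circle) : ℂ) * inner ℂ (U^[n] f) (U^[k] f) := by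
    intro z
    rw [dens_eq, mul_left_comm]
    congr 1
    rw [Finset.mul_sum]
    refine Finset.sum_congr rfl fun n _ => ?_
    rw [Finset.mul_sum]
    refine Finset.sum_congr rfl fun k _ => ?_
    rw [← mul_assoc]
    congr 1
    rw [← Circle.coe_pow, ← Circle.coe_mul, ← zpow_natCast, ← zpow_add]
    congr 2; ring
  simp_rw [h1]
  rw [integral_const_mul, integral_finsetSum]
  swap
  · intro n _
    exact cont_int _ (continuous_finsetSum _ fun k _ => (cont_zpow _).mul continuous_const)
  rw [mul_assoc]
  congr 1
  have h2 : ∀ n ∈ Finset.range N, ∫ z : Circle, ∑ k ∈ Finset.range N,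
      ((z ^ ((n : ℤ) + h - k) : Circle) : ℂ) * inner ℂ (U^[n] f) (U^[k] f) ∂hc =
      if n + h < N then inner ℂ f (U^[h] f) else 0 := by
    intro n _
    rw [integral_finsetSum]
    swap
    · intro n _
      exact cont_int _ ((cont_zpow _).mul continuous_const)
    simp_rw [integral_mul_const, hc_int]
    have : ∀ k : ℕ, ((n : ℤ) + h - k = 0) ↔ k = n + h := by intro k; omega
    simp_rw [this]
    simp only [ite_mul, one_mul, zero_mul, Finset.sum_ite_eq', Finset.mem_range, inner_iter']
  rw [Finset.sum_congr rfl h2, ← Finset.sum_filter, Finset.sum_const, nsmul_eq_mul]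
  congr 2
  have : (Finset.range N).filter (fun n => n + h < N) = Finset.range (N - h) := by
    ext x; simp; omega
  rw [this, Finset.card_range]

lemma herglotz (U : H →ₗᵢ[ℂ] H) (f : H) : ∃ σ : Measure Circle, IsFiniteMeasure σ ∧
    ∀ h : ℕ, ∫ z : Circle, (z : ℂ) ^ h ∂σ = inner ℂ f (U^[h] f) := by
  have hfin : ∀ N, IsFiniteMeasure (hc.withDensity fun z => ENNReal.ofReal (dens U f N z)) := by
    intro N
    refine isFiniteMeasure_withDensity_ofReal ?_
    exact (cont_int' hc (dens_cont U f N)).2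
  let s : ℕ → FiniteMeasure Circle := fun N =>
    ⟨hc.withDensity fun z => ENNReal.ofReal (dens U f N z), hfin N⟩
  have hInteg : ∀ (N : ℕ) (g : Circle → ℂ), ∫ z, g z ∂(s N : Measure Circle) =
      ∫ z, g z * (dens U f N z : ℂ) ∂hc := by
    intro N g
    change ∫ z, g z ∂(hc.withDensity fun z => ENNReal.ofReal (dens U f N z)) = _
    rw [integral_withDensity_eq_integral_toReal_smul
      ((dens_cont U f N).measurable.ennreal_ofReal) (by simp)]
    refine integral_congr_ae (Eventually.of_forall fun z => ?_)
    simp only [ENNReal.toReal_ofReal (dens_nonneg U f N z), Complex.real_smul, mul_comm]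
  have hmass : ∀ N, (s N).mass ≤ ‖f‖₊ ^ 2 := by
    intro N
    have h0 := hInteg N (fun _ => 1)
    have h1 := dens_moment U f N 0
    simp only [pow_zero, Function.iterate_zero, id] at h1
    rw [h1, integral_const] at h0
    have h2 : ((s N : Measure Circle).real Set.univ : ℝ) = ((s N).mass : ℝ) := rfl
    rw [h2] at h0
    have h3 := inner_self_eq_norm_sq_to_K (𝕜 := ℂ) f
    rw [h3] at h0
    have h4 : ((s N).mass : ℝ) = (N : ℝ)⁻¹ * N * ‖f‖ ^ 2 := by
      have := congrArg Complex.re h0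
      simp at this
      rw [this]
      norm_cast
    have h5 : ((s N).mass : ℝ) ≤ ‖f‖ ^ 2 := by
      rw [h4]
      rcases Nat.eq_zero_or_pos N with h | h
      · simp [h]; 
      · rw [inv_mul_cancel₀ (by exact_mod_cast h.ne'), one_mul]
    exact_mod_cast h5
  obtain ⟨σ, -, hσ⟩ := (isCompact_setOfPred_finiteMeasure_le_of_compactSpace Circle
    (‖f‖₊ ^ 2)).ultrafilter_le_nhds ((hyperfilter ℕ).map s) (by
      simp only [le_principal_iff]
      exact Ultrafilter.mem_coe.2 (Ultrafilter.mem_map.2 (univ_mem' hmass)))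
  have hσ' : Tendsto s (hyperfilter ℕ) (𝓝 σ) := hσ
  rw [FiniteMeasure.tendsto_iff_forall_integral_rclike_tendsto ℂ] at hσ'
  refine ⟨σ, inferInstance, fun h => ?_⟩
  have h1 := hσ' (BoundedContinuousFunction.mkOfCompact ⟨fun z : Circle => (z : ℂ) ^ h, by fun_prop⟩)
  simp only [BoundedContinuousFunction.mkOfCompact_apply, ContinuousMap.coe_mk, hInteg,
    dens_moment] at h1
  refine tendsto_nhds_unique h1 ?_
  have h2 : Tendsto (fun N : ℕ => (N : ℂ)⁻¹ * ((N - h : ℕ) : ℂ) * inner ℂ f (U^[h] f)) atTop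
      (𝓝 (1 * inner ℂ f (U^[h] f))) := by
    refine Tendsto.mul_const _ ?_
    have h3 : Tendsto (fun N : ℕ => 1 - (h : ℂ) * (N : ℂ)⁻¹) atTop (𝓝 (1 - (h : ℂ) * 0)) :=
      tendsto_const_nhds.sub (tendsto_const_nhds.mul tendsto_inv_atTop_nhds_zero_nat)
    simp only [mul_zero, sub_zero] at h3
    refine h3.congr' ?_
    filter_upwards [eventually_gt_atTop h] with N hN
    rw [Nat.cast_sub hN.le]
    have : (N : ℂ) ≠ 0 := by exact_mod_cast (by omega : N ≠ 0)
    field_simp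
  rw [one_mul] at h2
  exact h2.mono_left (Nat.hyperfilter_le_atTop)

end SumsetAux

namespace SumsetAux

variable {H : Type*} [NormedAddCommGroup H] [InnerProductSpace ℂ H]

lemma atom_zero [CompleteSpace H] (U : H →ₗᵢ[ℂ] H) (f : H) (σ : Measure Circle)
    [IsFiniteMeasure σ] (hσ : ∀ h : ℕ, ∫ z : Circle, (z : ℂ) ^ h ∂σ = inner ℂ f (U^[h] f))
    (w : Circle) (hf : ∀ g : H, U g = (w : ℂ) • g → inner ℂ f g = 0) : σ {w} = 0 := by
  classical
  -- averages
  have h1 : Tendsto (fun N : ℕ => ∫ z : Circle,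
      (N : ℂ)⁻¹ * ∑ n ∈ Finset.range N, ((w⁻¹ * z : Circle) : ℂ) ^ n ∂σ) atTop
      (𝓝 (∫ z : Circle, (if w⁻¹ * z = 1 then 1 else 0 : ℂ) ∂σ)) := by
    refine tendsto_integral_of_dominated_convergence (fun _ => (1 : ℝ)) ?_ ?_ ?_ ?_
    · intro N
      refine Continuous.aestronglyMeasurable ?_
      fun_prop
    · exact integrable_const _
    · intro N
      refine Eventually.of_forall fun z => ?_
      rw [norm_mul, norm_inv, Complex.norm_natCast]
      have : ‖∑ n ∈ Finset.range N, ((w⁻¹ * z : Circle) : ℂ) ^ n‖ ≤ N := by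
        refine (norm_sum_le _ _).trans ?_
        simp only [norm_pow, Circle.norm_coe, one_pow, Finset.sum_const, Finset.card_range,
          nsmul_eq_mul, mul_one, le_refl]
      rcases Nat.eq_zero_or_pos N with h | h
      · simp [h]
      · rw [inv_mul_le_iff₀ (by exact_mod_cast h), mul_one]; exact this
    · exact Eventually.of_forall fun z => circ_avg _
  have h2 : ∫ z : Circle, (if w⁻¹ * z = 1 then 1 else 0 : ℂ) ∂σ = (σ.real {w} : ℂ) := by
    have : ∀ z : Circle, (if w⁻¹ * z = 1 then 1 else 0 : ℂ)
        = Set.indicator {w} (fun _ => (1 : ℂ)) z := by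
      intro z
      simp only [Set.indicator_apply, Set.mem_singleton_iff, inv_mul_eq_one, eq_comm]
    simp_rw [this]
    rw [integral_indicator_const _ (measurableSet_singleton w)]
    simp
  rw [h2] at h1
  -- ergodic theorem
  let V : H →L[ℂ] H := (((w⁻¹ : Circle) : ℂ)) • U.toContinuousLinearMap
  have hV : ∀ g, V g = ((w⁻¹ : Circle) : ℂ) • U g := fun g => rfl
  have hV1 : ‖V‖ ≤ 1 := by
    refine ContinuousLinearMap.opNorm_le_bound _ zero_le_one fun x => ?_
    rw [hV, norm_smul, Circle.norm_coe, U.norm_map]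
  have hVn : ∀ n g, V^[n] g = (((w⁻¹ : Circle) : ℂ)) ^ n • U^[n] g := by
    intro n g
    induction n with
    | zero => simp
    | succ n ih =>
      rw [Function.iterate_succ_apply', Function.iterate_succ_apply', ih, hV, U.map_smul, smul_smul,
        pow_succ, mul_comm]
  have h3 := ContinuousLinearMap.tendsto_birkhoffAverage_orthogonalProjection V hV1 f
  have h4 := (tendsto_const_nhds (x := f)).inner (𝕜 := ℂ) h3
  set K := LinearMap.eqLocus (V : H →ₗ[ℂ] H) ((1 : H →L[ℂ] H) : H →ₗ[ℂ] H)
  have h5 : inner ℂ f ((K.orthogonalProjectionOnto f : H)) = 0 := by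
    apply hf
    have := (K.orthogonalProjectionOnto f).2
    rw [LinearMap.mem_eqLocus] at this
    have this : V (K.orthogonalProjectionOnto f : H) = (K.orthogonalProjectionOnto f : H) := this
    rw [hV] at this
    have h6 := congrArg (fun x => (w : ℂ) • x) this
    simp only [smul_smul, ← Circle.coe_mul] at h6
    simpa using h6
  rw [h5] at h4
  have h6 := tendsto_nhds_unique (h1.congr ?_) h4
  · have : σ.real {w} = 0 := by exact_mod_cast h6
    rwa [measureReal_eq_zero_iff] at this
  intro N
  rw [integral_const_mul, integral_finsetSum]
  swap
  · intro n _
    exact cont_int _ (by fun_prop)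
  simp only [birkhoffAverage, birkhoffSum, inner_smul_right, inner_sum, hVn, id]
  congr 1
  refine Finset.sum_congr rfl fun n _ => ?_
  rw [← hσ, ← integral_const_mul]
  simp only [Circle.coe_mul, mul_pow]

lemma avg_sq (U : H →ₗᵢ[ℂ] H) (f : H) (σ : Measure Circle)
    [IsFiniteMeasure σ] (hσ : ∀ h : ℕ, ∫ z : Circle, (z : ℂ) ^ h ∂σ = inner ℂ f (U^[h] f))
    (h0 : ∀ w, σ {w} = 0) :
    Tendsto (fun N : ℕ => (N : ℝ)⁻¹ * ∑ h ∈ Finset.range N, ‖inner ℂ f (U^[h] f)‖ ^ 2) atTop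
      (𝓝 0) := by
  classical
  have h1 : Tendsto (fun N : ℕ => ∫ z : Circle × Circle,
      (N : ℂ)⁻¹ * ∑ n ∈ Finset.range N, ((z.1 * z.2⁻¹ : Circle) : ℂ) ^ n ∂(σ.prod σ)) atTop
      (𝓝 (∫ z : Circle × Circle, (if z.1 * z.2⁻¹ = 1 then 1 else 0 : ℂ) ∂(σ.prod σ))) := by
    refine tendsto_integral_of_dominated_convergence (fun _ => (1 : ℝ)) ?_ ?_ ?_ ?_
    · intro N
      refine Continuous.aestronglyMeasurable ?_
      fun_prop
    · exact integrable_const _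
    · intro N
      refine Eventually.of_forall fun z => ?_
      rw [norm_mul, norm_inv, Complex.norm_natCast]
      have : ‖∑ n ∈ Finset.range N, ((z.1 * z.2⁻¹ : Circle) : ℂ) ^ n‖ ≤ N := by
        refine (norm_sum_le _ _).trans ?_
        simp only [norm_pow, Circle.norm_coe, one_pow, Finset.sum_const, Finset.card_range,
          nsmul_eq_mul, mul_one, le_refl]
      rcases Nat.eq_zero_or_pos N with h | h
      · simp [h]
      · rw [inv_mul_le_iff₀ (by exact_mod_cast h), mul_one]; exact this
    · exact Eventually.of_forall fun z => circ_avg _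
  have h2 : ∫ z : Circle × Circle, (if z.1 * z.2⁻¹ = 1 then 1 else 0 : ℂ) ∂(σ.prod σ) = 0 := by
    have hm : MeasurableSet (Set.diagonal Circle) := isClosed_diagonal.measurableSet
    have hz : (σ.prod σ) (Set.diagonal Circle) = 0 := by
      rw [Measure.prod_apply hm]
      have : ∀ x : Circle, Prod.mk x ⁻¹' Set.diagonal Circle = {x} := by
        intro x; ext y; simp [eq_comm]
      simp [this, h0]
    refine integral_eq_zero_of_ae ?_
    filter_upwards [compl_mem_ae_iff.2 hz] with z hz
    rw [if_neg]; · rfl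
    intro h
    exact hz (mul_inv_eq_one.1 h)
  rw [h2] at h1
  have h3 := h1.norm
  rw [norm_zero] at h3
  refine h3.congr fun N => ?_
  rw [integral_const_mul, integral_finsetSum]
  swap
  · intro n _
    exact cont_int _ (by fun_prop)
  have h4 : ∀ n, ∫ z : Circle × Circle, ((z.1 * z.2⁻¹ : Circle) : ℂ) ^ n ∂(σ.prod σ) =
      ((‖inner ℂ f (U^[n] f)‖ ^ 2 : ℝ) : ℂ) := by
    intro n
    have : ∀ z : Circle × Circle, ((z.1 * z.2⁻¹ : Circle) : ℂ) ^ n =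
        (z.1 : ℂ) ^ n * (starRingEnd ℂ) ((z.2 : ℂ) ^ n) := by
      intro z
      rw [Circle.coe_mul, mul_pow, Circle.coe_inv_eq_conj, map_pow]
    simp_rw [this]
    rw [integral_prod_mul (fun z : Circle => (z : ℂ) ^ n)
      (fun z : Circle => (starRingEnd ℂ) ((z : ℂ) ^ n)), integral_conj, hσ, Complex.mul_conj,
      Complex.normSq_eq_norm_sq]
  simp_rw [h4]
  rw [← Complex.ofReal_sum, norm_mul, norm_inv, Complex.norm_natCast, Complex.norm_real,
    Real.norm_of_nonneg (Finset.sum_nonneg fun _ _ => by positivity)]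

lemma avg_abs (a : ℕ → ℝ) 
    (h : Tendsto (fun N : ℕ => (N : ℝ)⁻¹ * ∑ h ∈ Finset.range N, a h ^ 2) atTop (𝓝 0)) :
    Tendsto (fun N : ℕ => (N : ℝ)⁻¹ * ∑ h ∈ Finset.range N, |a h|) atTop (𝓝 0) := by
  have h1 : Tendsto (fun N : ℕ => √((N : ℝ)⁻¹ * ∑ h ∈ Finset.range N, a h ^ 2)) atTop (𝓝 0) := by
    have := h.sqrt
    simpa using this
  refine squeeze_zero (fun N => by positivity) (fun N => ?_) h1
  refine Real.le_sqrt_of_sq_le ?_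
  rw [mul_pow]
  have := sq_sum_le_card_mul_sum_sq (s := Finset.range N) (f := fun h => |a h|)
  simp only [sq_abs, Finset.card_range] at this
  rcases Nat.eq_zero_or_pos N with h | h
  · simp [h]
  · calc (N : ℝ)⁻¹ ^ 2 * (∑ h ∈ Finset.range N, |a h|) ^ 2
        ≤ (N : ℝ)⁻¹ ^ 2 * (N * ∑ h ∈ Finset.range N, a h ^ 2) := by gcongr
      _ = _ := by have : (N : ℝ) ≠ 0 := by exact_mod_cast h.ne'
                  field_simp

lemma sum_dist_le (g : ℕ → ℝ) (hg : ∀ n, 0 ≤ g n) (N n : ℕ) (hn : n < N) :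
    ∑ k ∈ Finset.range N, g ((n - k) + (k - n)) ≤ 2 * ∑ h ∈ Finset.range N, g h := by
  have h1 : ∑ k ∈ (Finset.range N).filter (fun k => k ≤ n), g ((n - k) + (k - n)) ≤
      ∑ h ∈ Finset.range N, g h := by
    rw [← Finset.sum_image (f := g) (g := fun k => (n - k) + (k - n))]
    · refine Finset.sum_le_sum_of_subset_of_nonneg ?_ fun _ _ _ => hg _
      intro x; simp; intro y; omega
    · intro x hx y hy; simp at *; omega
  have h2 : ∑ k ∈ (Finset.range N).filter (fun k => ¬ k ≤ n), g ((n - k) + (k - n)) ≤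
      ∑ h ∈ Finset.range N, g h := by
    rw [← Finset.sum_image (f := g) (g := fun k => (n - k) + (k - n))]
    · refine Finset.sum_le_sum_of_subset_of_nonneg ?_ fun _ _ _ => hg _
      intro x; simp; intro y; omega
    · intro x hx y hy; simp at *; omega
  rw [← Finset.sum_filter_add_sum_filter_not (Finset.range N) (fun k => k ≤ n)]
  linarith

/-- Weak mixing vectors have small weighted averages, uniformly in the weights. -/
lemma wm_avg [CompleteSpace H] (U : H →ₗᵢ[ℂ] H) (f : H)
    (hf : ∀ (w : Circle) (g : H), U g = (w : ℂ) • g → inner ℂ f g = 0) :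
    ∃ a : ℕ → ℝ, Tendsto a atTop (𝓝 0) ∧ ∀ (N : ℕ) (c : ℕ → ℂ), (∀ n, ‖c n‖ ≤ 1) →
      ‖(N : ℂ)⁻¹ • ∑ n ∈ Finset.range N, c n • U^[n] f‖ ≤ a N := by
  obtain ⟨σ, _, hσ⟩ := herglotz U f
  have h0 := fun w => atom_zero U f σ hσ w (hf w)
  have h1 := avg_abs (fun h => ‖inner ℂ f (U^[h] f)‖) (avg_sq U f σ hσ h0)
  simp only [abs_norm] at h1
  refine ⟨fun N => √(2 * ((N : ℝ)⁻¹ * ∑ h ∈ Finset.range N, ‖inner ℂ f (U^[h] f)‖)), ?_, ?_⟩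
  · have := (h1.const_mul 2).sqrt
    simpa using this
  intro N c hc
  refine Real.le_sqrt_of_sq_le ?_
  rw [norm_smul, norm_inv, Complex.norm_natCast, mul_pow]
  rcases Nat.eq_zero_or_pos N with h | h
  · simp [h]
  have hN : (0 : ℝ) < N := by exact_mod_cast h
  have hin : ∀ n k : ℕ, ‖inner ℂ (U^[n] f) (U^[k] f)‖ = ‖inner ℂ f (U^[(n - k) + (k - n)] f)‖ := by
    intro n k
    rcases le_total n k with h | h
    · obtain ⟨j, rfl⟩ := Nat.exists_eq_add_of_le h
      rw [inner_iter']; congr 4; omega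
    · obtain ⟨j, rfl⟩ := Nat.exists_eq_add_of_le h
      rw [norm_inner_symm, inner_iter']; congr 4; omega
  have key : ‖∑ n ∈ Finset.range N, c n • U^[n] f‖ ^ 2 ≤
      N * (2 * ∑ h ∈ Finset.range N, ‖inner ℂ f (U^[h] f)‖) := by
    have h2 := inner_self_eq_norm_sq_to_K (𝕜 := ℂ) (∑ n ∈ Finset.range N, c n • U^[n] f)
    have h3 := congrArg norm h2
    rw [norm_pow, RCLike.norm_ofReal, abs_norm] at h3
    rw [← h3, sum_inner]
    refine (norm_sum_le _ _).trans ?_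
    have : ∀ n ∈ Finset.range N, ‖inner ℂ (c n • U^[n] f) (∑ n ∈ Finset.range N, c n • U^[n] f)‖ ≤
        2 * ∑ h ∈ Finset.range N, ‖inner ℂ f (U^[h] f)‖ := by
      intro n hn
      rw [inner_sum]
      refine (norm_sum_le _ _).trans ?_
      refine le_trans (Finset.sum_le_sum fun k _ => ?_)
        (sum_dist_le (fun h => ‖inner ℂ f (U^[h] f)‖) (fun _ => norm_nonneg _) N n
          (Finset.mem_range.1 hn))
      rw [inner_smul_left, inner_smul_right, norm_mul, norm_mul, RCLike.norm_conj, hin]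
      have hc1 := hc n
      have hc2 := hc k
      calc ‖c n‖ * (‖c k‖ * ‖inner ℂ f (U^[(n - k) + (k - n)] f)‖)
          ≤ 1 * (1 * ‖inner ℂ f (U^[(n - k) + (k - n)] f)‖) := by gcongr
        _ = _ := by ring
    refine (Finset.sum_le_sum this).trans ?_
    rw [Finset.sum_const, Finset.card_range, nsmul_eq_mul]
  calc (N : ℝ)⁻¹ ^ 2 * ‖∑ n ∈ Finset.range N, c n • U^[n] f‖ ^ 2
      ≤ (N : ℝ)⁻¹ ^ 2 * (N * (2 * ∑ h ∈ Finset.range N, ‖inner ℂ f (U^[h] f)‖)) := by gcongr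
    _ = _ := by field_simp

end SumsetAux

namespace SumsetAux

lemma int_norm_le {Y : Type*} [MeasurableSpace Y] (ν : Measure Y) [IsProbabilityMeasure ν]
    (g : Lp ℂ 2 ν) : ∫ y, ‖g y‖ ∂ν ≤ ‖g‖ := by
  have h1 : eLpNorm g 1 ν ≤ eLpNorm g 2 ν :=
    eLpNorm_le_eLpNorm_of_exponent_le (by norm_num) (Lp.aestronglyMeasurable g)
  rw [Lp.norm_def, integral_norm_eq_lintegral_enorm (Lp.aestronglyMeasurable g),
    ← eLpNorm_one_eq_lintegral_enorm]
  exact ENNReal.toReal_mono (Lp.eLpNorm_ne_top g) h1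

lemma Lp_int {Y : Type*} [MeasurableSpace Y] (ν : Measure Y) [IsProbabilityMeasure ν]
    (g : Lp ℂ 2 ν) : Integrable g ν :=
  (Lp.memLp g).integrable (by norm_num)

/-- Decomposition lemma. -/
lemma decomp {Y : Type*} [MeasurableSpace Y] (ν : Measure Y) [IsProbabilityMeasure ν]
    (S : Y → Y) (hS : MeasurePreserving S ν ν) (f : Y → ℂ) (hf : MemLp f 2 ν) (η : ℝ) (hη : 0 < η) :
    ∃ (k : ℕ) (lam : Fin k → Circle) (g : Fin k → Y → ℂ) (fw ft : Y → ℂ) (a : ℕ → ℝ),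
      (∀ i, StronglyMeasurable (g i)) ∧ (∀ i, Integrable (g i) ν) ∧
      (∀ i, ∀ᵐ y ∂ν, g i (S y) = lam i * g i y) ∧
      StronglyMeasurable fw ∧ Integrable fw ν ∧ StronglyMeasurable ft ∧ Integrable ft ν ∧
      ∫ y, ‖ft y‖ ∂ν ≤ η ∧ (∀ᵐ y ∂ν, f y = fw y + ft y + ∑ i, g i y) ∧
      Tendsto a atTop (𝓝 0) ∧ ∀ (N : ℕ) (c : ℕ → ℂ), (∀ n, ‖c n‖ ≤ 1) →
        ∫ y, ‖(N : ℂ)⁻¹ * ∑ n ∈ Finset.range N, c n * fw (S^[n] y)‖ ∂ν ≤ a N := by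
  let U : Lp ℂ 2 ν →ₗᵢ[ℂ] Lp ℂ 2 ν := Lp.compMeasurePreservingₗᵢ ℂ S hS
  have hU : ∀ g : Lp ℂ 2 ν, U g =ᵐ[ν] g ∘ S := fun g => Lp.coeFn_compMeasurePreserving g hS
  have hUn : ∀ (n : ℕ) (g : Lp ℂ 2 ν), U^[n] g =ᵐ[ν] g ∘ S^[n] := by
    intro n g
    have h1 : (U^[n] g) = Lp.compMeasurePreserving S^[n] (hS.iterate n) g := by
      rw [← Lp.compMeasurePreserving_iterate]; rfl
    rw [h1]
    exact Lp.coeFn_compMeasurePreserving g _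
  let F : Lp ℂ 2 ν := hf.toLp f
  let E : Set (Lp ℂ 2 ν) := {g | ∃ w : Circle, U g = (w : ℂ) • g}
  let V : Submodule ℂ (Lp ℂ 2 ν) := (Submodule.span ℂ E).topologicalClosure
  have : CompleteSpace V := (Submodule.isClosed_topologicalClosure _).completeSpace_coe
  let P : Lp ℂ 2 ν := V.orthogonalProjectionOnto F
  have hPV : P ∈ V := (V.orthogonalProjectionOnto F).2
  have hPcl : P ∈ closure (Submodule.span ℂ E : Set (Lp ℂ 2 ν)) := hPV
  obtain ⟨v, hv, hPv⟩ := Metric.mem_closure_iff.1 hPcl η hη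
  obtain ⟨k, cs, gs, hsum⟩ := Submodule.mem_span_set'.1 hv
  have hperp : ∀ (w : Circle) (g : Lp ℂ 2 ν), U g = (w : ℂ) • g → inner ℂ (F - P) g = 0 := by
    intro w g hg
    have hgV : g ∈ V := Submodule.le_topologicalClosure _ (Submodule.subset_span ⟨w, hg⟩)
    have := V.sub_starProjection_mem_orthogonal F
    rw [Submodule.mem_orthogonal'] at this
    exact this g hgV
  obtain ⟨a, ha, haN⟩ := wm_avg U (F - P) hperp
  choose lam hlam using fun i => (gs i).2
  refine ⟨k, lam, fun i => (cs i • (gs i : Lp ℂ 2 ν) : Lp ℂ 2 ν), (F - P : Lp ℂ 2 ν),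
    (P - v : Lp ℂ 2 ν), a, fun i => Lp.stronglyMeasurable _, fun i => Lp_int _ _, ?_,
    Lp.stronglyMeasurable _, Lp_int _ _, Lp.stronglyMeasurable _, Lp_int _ _, ?_, ?_, ha, ?_⟩
  · intro i
    have h1 : U (cs i • (gs i : Lp ℂ 2 ν)) = (lam i : ℂ) • (cs i • (gs i : Lp ℂ 2 ν)) := by
      rw [U.map_smul, hlam, smul_comm]
    have h2 := hU (cs i • (gs i : Lp ℂ 2 ν))
    rw [h1] at h2
    filter_upwards [h2, Lp.coeFn_smul (lam i : ℂ) (cs i • (gs i : Lp ℂ 2 ν))] with y h3 h4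
    rw [h4] at h3
    exact h3.symm
  · refine (int_norm_le ν _).trans ?_
    rw [dist_eq_norm] at hPv
    exact hPv.le
  · have h1 : F = (F - P) + (P - v) + ∑ i, cs i • (gs i : Lp ℂ 2 ν) := by
      rw [hsum]; abel
    have h2 := hf.coeFn_toLp
    have h3 := Lp.coeFn_add ((F - P) + (P - v)) (∑ i, cs i • (gs i : Lp ℂ 2 ν))
    have h4 := Lp.coeFn_add (F - P) (P - v)
    have h5 := Lp.coeFn_finsetSum Finset.univ (fun i => cs i • (gs i : Lp ℂ 2 ν))
    rw [← h1] at h3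
    filter_upwards [h2, h3, h4, h5] with y h2 h3 h4 h5
    rw [← h2]
    change F y = _
    rw [h3, Pi.add_apply, h4, Pi.add_apply, h5]
    simp
  · intro N c hc
    refine le_trans (le_of_eq ?_) ((int_norm_le ν _).trans (haN N c hc))
    refine integral_congr_ae ?_
    have h1 := Lp.coeFn_smul (N : ℂ)⁻¹ (∑ n ∈ Finset.range N, c n • U^[n] (F - P))
    have h2 := Lp.coeFn_finsetSum (Finset.range N) (fun n => c n • U^[n] (F - P))
    have h3 : ∀ᵐ y ∂ν, ∀ n, (c n • U^[n] (F - P) : Lp ℂ 2 ν) y = c n * (F - P : Lp ℂ 2 ν) (S^[n] y) := by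
      rw [ae_all_iff]
      intro n
      filter_upwards [Lp.coeFn_smul (c n) (U^[n] (F - P)), hUn n (F - P)] with y h3 h4
      rw [h3, Pi.smul_apply, h4]; rfl
    filter_upwards [h1, h2, h3] with y h1 h2 h3
    rw [h1, Pi.smul_apply, h2]
    simp only [Finset.sum_apply, h3, smul_eq_mul]

end SumsetAux

namespace SumsetAux

open scoped Classical in
/-- Folner sets in a commutative group. -/
lemma folner {G : Type*} [CommGroup G] (Λ : Finset G) (κ : ℝ) (hκ : 0 < κ) :
    ∃ E : Finset G, E.Nonempty ∧ ∀ w ∈ Λ,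
      (1 - κ) * (E.card : ℝ) ≤ ((E.filter (fun x => w * x ∈ E)).card : ℝ) := by
  let B : ℕ → Finset G := fun n => Finset.univ.image (fun a : Λ → Fin n => ∏ i : Λ, (i : G) ^ (a i : ℕ))
  have hcard : ∀ n, (B n).card ≤ n ^ Λ.card := by
    intro n
    refine Finset.card_image_le.trans ?_
    simp
  have hmem : ∀ n x, x ∈ B n ↔ ∃ a : Λ → ℕ, (∀ i, a i < n) ∧ ∏ i : Λ, (i : G) ^ (a i) = x := by
    intro n x
    simp only [B, Finset.mem_image, Finset.mem_univ, true_and]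
    constructor
    · rintro ⟨a, rfl⟩
      exact ⟨fun i => a i, fun i => (a i).2, rfl⟩
    · rintro ⟨a, ha, rfl⟩
      exact ⟨fun i => ⟨a i, ha i⟩, rfl⟩
  have hsub : ∀ n, B n ⊆ B (n + 1) := by
    intro n x hx
    rw [hmem] at hx ⊢
    obtain ⟨a, ha, rfl⟩ := hx
    exact ⟨a, fun i => (ha i).trans (Nat.lt_succ_self n), rfl⟩
  have hmul : ∀ n, ∀ w ∈ Λ, ∀ x ∈ B n, w * x ∈ B (n + 1) := by
    intro n w hw x hx
    rw [hmem] at hx ⊢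
    obtain ⟨a, ha, rfl⟩ := hx
    refine ⟨fun i => a i + if i = ⟨w, hw⟩ then 1 else 0, fun i => ?_, ?_⟩
    · have := ha i
      show a i + _ < n + 1
      split_ifs <;> omega
    · simp only [pow_add, Finset.prod_mul_distrib]
      rw [mul_comm]
      congr 1
      rw [Finset.prod_eq_single (⟨w, hw⟩ : Λ)]
      · simp
      · intro b _ hb; simp [hb]
      · simp
  have hne : ∀ n, (B (n + 1)).Nonempty := by
    intro n
    exact ⟨1, (hmem _ _).2 ⟨fun _ => 0, fun _ => Nat.succ_pos n, by simp⟩⟩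
  have hex : ∃ n, ((B (n + 2)).card : ℝ) ≤ (1 + κ) * (B (n + 1)).card := by
    by_contra! hcon
    have hgrow : ∀ n, (1 + κ) ^ n ≤ ((B (n + 1)).card : ℝ) := by
      intro n
      induction n with
      | zero => 
        have := (hne 0).card_pos
        simpa using this
      | succ n ih =>
        rw [pow_succ, mul_comm]
        refine le_trans ?_ (hcon n).le
        gcongr
    have hlim := tendsto_pow_const_div_const_pow_of_one_lt Λ.card (r := 1 + κ) (by linarith)
    have hev := (hlim.comp (tendsto_add_atTop_nat 1)).eventually_lt_const
      (show (0 : ℝ) < 1 / (1 + κ) by positivity)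
    obtain ⟨n, hn⟩ := hev.exists
    simp only [Function.comp] at hn
    have h1 : (1 + κ) ^ n ≤ ((n + 1 : ℕ) : ℝ) ^ Λ.card :=
      (hgrow n).trans (by exact_mod_cast hcard (n + 1))
    rw [div_lt_div_iff₀ (by positivity) (by positivity), pow_succ] at hn
    nlinarith
  obtain ⟨n, hn⟩ := hex
  refine ⟨B (n + 1), hne n, fun w hw => ?_⟩
  have h1 : ((B (n + 1)).filter (fun x => ¬ (w * x ∈ B (n + 1)))).card ≤
      (B (n + 2) \ B (n + 1)).card := by
    refine Finset.card_le_card_of_injOn (fun x => w * x) ?_ ?_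
    · intro x hx
      simp only [Finset.coe_filter, Set.mem_ofPred_eq] at hx
      simp only [Finset.coe_sdiff, Set.mem_sdiff, Finset.mem_coe]
      exact ⟨hmul _ w hw x hx.1, hx.2⟩
    · intro x _ y _ h
      exact mul_left_cancel h
  have h2 := Finset.card_filter_add_card_filter_not (s := B (n + 1)) (fun x => w * x ∈ B (n + 1))
  have h3 := Finset.card_sdiff_add_card_eq_card (hsub (n + 1))
  have h1' : (((B (n + 1)).filter (fun x => ¬ (w * x ∈ B (n + 1)))).card : ℝ) ≤
      ((B (n + 2) \ B (n + 1)).card : ℝ) := by exact_mod_cast h1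
  have h2' : (((B (n + 1)).filter (fun x => w * x ∈ B (n + 1))).card : ℝ) +
    ((B (n + 1)).filter (fun x => ¬ (w * x ∈ B (n + 1)))).card = (B (n + 1)).card := by
    exact_mod_cast h2
  have h3' : ((B (n + 2) \ B (n + 1)).card : ℝ) + (B (n + 1)).card = (B (n + 2)).card := by
    exact_mod_cast h3
  linarith

end SumsetAux

namespace SumsetAux

/-- twist of a character -/
noncomputable def tw (n : ℕ) (b : Circle →* Circle) : Circle →* Circle := powMonoidHom n * b

lemma tw_apply (n : ℕ) (b : Circle →* Circle) (w : Circle) : tw n b w = w ^ n * b w := rfl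

/-- Fejer type kernel -/
noncomputable def Psi (E : Finset Circle) (a : Circle →* Circle) : ℝ :=
  (E.card : ℝ)⁻¹ * ‖∑ x ∈ E, (a x : ℂ)‖ ^ 2

lemma Psi_nonneg (E : Finset Circle) (a : Circle →* Circle) : 0 ≤ Psi E a := by
  unfold Psi; positivity

lemma Psi_le (E : Finset Circle) (a : Circle →* Circle) : Psi E a ≤ E.card := by
  unfold Psi
  have h : ‖∑ x ∈ E, (a x : ℂ)‖ ≤ E.card := by
    refine (norm_sum_le _ _).trans ?_
    simp only [Circle.norm_coe, Finset.sum_const, nsmul_eq_mul, mul_one, le_refl]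
  rcases Nat.eq_zero_or_pos E.card with h0 | h0
  · simp [h0]
  · have h1 : (0 : ℝ) < E.card := by exact_mod_cast h0
    rw [inv_mul_le_iff₀ h1]
    have := norm_nonneg (∑ x ∈ E, (a x : ℂ))
    nlinarith

lemma Psi_eq (E : Finset Circle) (a : Circle →* Circle) :
    (Psi E a : ℂ) = (E.card : ℂ)⁻¹ * ∑ x ∈ E ×ˢ E, (a (x.1 / x.2) : ℂ) := by
  unfold Psi
  rw [Complex.ofReal_mul, Complex.ofReal_inv, Complex.ofReal_natCast, ← Complex.normSq_eq_norm_sq,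
    ← Complex.mul_conj, map_sum, Finset.sum_mul_sum, Finset.sum_product]
  congr 1
  refine Finset.sum_congr rfl fun x _ => Finset.sum_congr rfl fun y _ => ?_
  rw [map_div, div_eq_mul_inv, Circle.coe_mul, Circle.coe_inv_eq_conj]

open scoped Classical in
lemma unif_one (w : Circle) (q s : ℕ) (ε : ℝ) (hε : 0 < ε) : ∀ᶠ N : ℕ in atTop,
    ∀ b : Circle →* Circle,
      ‖(N : ℂ)⁻¹ * ∑ n ∈ Finset.range N, (tw (q * n + s) b w : ℂ)
        - if w ^ q = 1 then ((w ^ s * b w : Circle) : ℂ) else 0‖ ≤ ε := by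
  have h1 := circ_avg (w ^ q)
  rw [tendsto_iff_norm_sub_tendsto_zero] at h1
  filter_upwards [h1.eventually_lt_const hε] with N hN b
  have h2 : (N : ℂ)⁻¹ * ∑ n ∈ Finset.range N, (tw (q * n + s) b w : ℂ)
        - (if w ^ q = 1 then ((w ^ s * b w : Circle) : ℂ) else 0) =
      ((w ^ s * b w : Circle) : ℂ) * ((N : ℂ)⁻¹ * ∑ n ∈ Finset.range N, ((w ^ q : Circle) : ℂ) ^ n
        - if w ^ q = 1 then 1 else 0) := by
    have h3 : ∑ n ∈ Finset.range N, (tw (q * n + s) b w : ℂ) =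
        ((w ^ s * b w : Circle) : ℂ) * ∑ n ∈ Finset.range N, ((w ^ q : Circle) : ℂ) ^ n := by
      rw [Finset.mul_sum]
      refine Finset.sum_congr rfl fun n _ => ?_
      rw [tw_apply, ← Circle.coe_pow, ← Circle.coe_mul, pow_add, pow_mul]
      congr 1
      rw [mul_assoc, mul_comm]
    rw [mul_sub, mul_left_comm, h3]
    congr 1
    · split_ifs <;> simp
  rw [h2, norm_mul, Circle.norm_coe, one_mul]
  exact hN.le

open scoped Classical in
lemma unif_sum {ι : Type*} (D : Finset ι) (h : ι → Circle) (q s : ℕ) (ε : ℝ) (hε : 0 < ε) :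
    ∀ᶠ N : ℕ in atTop, ∀ b : Circle →* Circle,
      ‖(N : ℂ)⁻¹ * ∑ n ∈ Finset.range N, ∑ x ∈ D, (tw (q * n + s) b (h x) : ℂ)
        - ∑ x ∈ D, if (h x) ^ q = 1 then (((h x) ^ s * b (h x) : Circle) : ℂ) else 0‖ ≤ ε := by
  have hε' : 0 < ε / (D.card + 1) := by positivity
  have h1 : ∀ᶠ N : ℕ in atTop, ∀ x ∈ D, ∀ b : Circle →* Circle,
      ‖(N : ℂ)⁻¹ * ∑ n ∈ Finset.range N, (tw (q * n + s) b (h x) : ℂ)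
        - if (h x) ^ q = 1 then (((h x) ^ s * b (h x) : Circle) : ℂ) else 0‖ ≤ ε / (D.card + 1) := by
    rw [Filter.eventually_all_finset]
    intro x _
    exact unif_one (h x) q s _ hε'
  filter_upwards [h1] with N hN b
  rw [Finset.sum_comm, Finset.mul_sum, ← Finset.sum_sub_distrib]
  refine (norm_sum_le _ _).trans ((Finset.sum_le_sum fun x hx => hN x hx b).trans ?_)
  rw [Finset.sum_const, nsmul_eq_mul, mul_div_assoc', div_le_iff₀ (by positivity)]
  nlinarith

open scoped Classical in
lemma psi_unif (E : Finset Circle) (w : Circle) (q s : ℕ) (ε : ℝ) (hε : 0 < ε) :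
    ∀ᶠ N : ℕ in atTop, ∀ b : Circle →* Circle,
      ‖(N : ℂ)⁻¹ * ∑ n ∈ Finset.range N, (Psi E (tw (q * n + s) b) : ℂ) * (tw (q * n + s) b w : ℂ)
        - (E.card : ℂ)⁻¹ * ∑ x ∈ E ×ˢ E, if (x.1 / x.2 * w) ^ q = 1 then
          (((x.1 / x.2 * w) ^ s * b (x.1 / x.2 * w) : Circle) : ℂ) else 0‖ ≤ ε := by
  filter_upwards [unif_sum (E ×ˢ E) (fun x => x.1 / x.2 * w) q s ε hε] with N hN b
  have h1 : (N : ℂ)⁻¹ * ∑ n ∈ Finset.range N, (Psi E (tw (q * n + s) b) : ℂ) * (tw (q * n + s) b w : ℂ)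
      = (E.card : ℂ)⁻¹ * ((N : ℂ)⁻¹ * ∑ n ∈ Finset.range N, ∑ x ∈ E ×ˢ E,
        (tw (q * n + s) b (x.1 / x.2 * w) : ℂ)) := by
    rw [mul_left_comm]
    congr 1
    rw [Finset.mul_sum]
    refine Finset.sum_congr rfl fun n _ => ?_
    rw [Psi_eq, mul_assoc, Finset.sum_mul]
    congr 1
    refine Finset.sum_congr rfl fun x _ => ?_
    rw [map_mul, Circle.coe_mul]
  rw [h1, ← mul_sub, norm_mul, norm_inv, Complex.norm_natCast]
  have h2 := hN b
  rcases Nat.eq_zero_or_pos E.card with h0 | h0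
  · simp [h0, hε.le]
  · have h3 : (1 : ℝ) ≤ E.card := by exact_mod_cast h0
    have h4 : (E.card : ℝ)⁻¹ ≤ 1 := inv_le_one_of_one_le₀ h3
    calc _ ≤ 1 * ε := by gcongr
      _ = ε := one_mul _

open scoped Classical in
lemma cntE (E : Finset Circle) (w : Circle) :
    ((E ×ˢ E).filter (fun x => x.1 / x.2 = w)).card = (E.filter (fun x => w * x ∈ E)).card := by
  refine Finset.card_nbij' (fun x => x.2) (fun x => (w * x, x)) ?_ ?_ ?_ ?_
  · rintro ⟨x, y⟩ h
    simp only [Finset.coe_filter, Finset.mem_product, Set.mem_ofPred_eq] at h ⊢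
    refine ⟨h.1.2, ?_⟩
    rw [← h.2, div_mul_cancel]; exact h.1.1
  · intro x h
    simp only [Finset.coe_filter, Finset.mem_product, Set.mem_ofPred_eq] at h ⊢
    exact ⟨⟨h.2, h.1⟩, by simp⟩
  · rintro ⟨x, y⟩ h
    simp only [Finset.coe_filter, Finset.mem_product, Set.mem_ofPred_eq] at h ⊢
    rw [← h.2, div_mul_cancel]
  · intro x h; rfl

/-- the averaged correlation -/
noncomputable def corr (E : Finset Circle) (w : Circle) : ℝ :=
  open scoped Classical in (E.card : ℝ)⁻¹ * (E.filter (fun x => w * x ∈ E)).card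

lemma corr_one {E : Finset Circle} (hE : E.Nonempty) : corr E 1 = 1 := by
  classical
  unfold corr
  have : E.filter (fun x => 1 * x ∈ E) = E := by ext; simp
  rw [this, inv_mul_cancel₀]
  exact_mod_cast hE.card_pos.ne'

lemma corr_inv (E : Finset Circle) (w : Circle) : corr E w⁻¹ = corr E w := by
  classical
  unfold corr
  congr 2
  refine Finset.card_nbij' (fun x => w⁻¹ * x) (fun x => w * x) ?_ ?_ ?_ ?_ <;>
    intro x h <;> simp_all

lemma corr_le {E : Finset Circle} (hE : E.Nonempty) (w : Circle) : corr E w ≤ 1 := by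
  classical
  unfold corr
  have h1 : (0 : ℝ) < E.card := by exact_mod_cast hE.card_pos
  rw [inv_mul_le_iff₀ h1, mul_one]
  exact_mod_cast Finset.card_filter_le _ _

lemma psi_unif_corr (E : Finset Circle) (w : Circle) (ε : ℝ) (hε : 0 < ε) :
    ∀ᶠ N : ℕ in atTop, ∀ b : Circle →* Circle,
      ‖(N : ℂ)⁻¹ * ∑ n ∈ Finset.range N, (Psi E (tw n b) : ℂ) * (tw n b w : ℂ)
        - (corr E w : ℂ)‖ ≤ ε := by
  classical
  filter_upwards [psi_unif E w 1 0 ε hε] with N hN b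
  have h1 := hN b
  simp only [one_mul, add_zero, pow_one, pow_zero] at h1
  convert h1 using 3
  rw [← corr_inv]
  unfold corr
  rw [Complex.ofReal_mul, Complex.ofReal_inv, Complex.ofReal_natCast, Complex.ofReal_natCast,
    ← cntE, Finset.card_filter, Nat.cast_sum]
  congr 1
  refine Finset.sum_congr rfl fun x _ => ?_
  by_cases hx : x.1 / x.2 * w = 1
  · have : x.1 / x.2 = w⁻¹ := mul_eq_one_iff_eq_inv.1 hx
    rw [if_pos this, if_pos hx, hx]; simp
  · have : ¬ (x.1 / x.2 = w⁻¹) := fun h => hx (mul_eq_one_iff_eq_inv.2 h)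
    rw [if_neg this, if_neg hx]; simp

lemma psi_unif_one {E : Finset Circle} (hE : E.Nonempty) (ε : ℝ) (hε : 0 < ε) :
    ∀ᶠ N : ℕ in atTop, ∀ b : Circle →* Circle,
      |(N : ℝ)⁻¹ * ∑ n ∈ Finset.range N, Psi E (tw n b) - 1| ≤ ε := by
  filter_upwards [psi_unif_corr E 1 ε hε] with N hN b
  have h1 := hN b
  rw [corr_one hE] at h1
  simp only [map_one, Circle.coe_one, mul_one] at h1
  rw [← Real.norm_eq_abs, ← Complex.norm_real]
  push_cast
  push_cast at h1
  exact h1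

lemma psi_unif_res (E : Finset Circle) (q s : ℕ) (R : Finset Circle)
    (hR : ∀ w, w ∈ R ↔ w ^ q = 1) (ε : ℝ) (hε : 0 < ε) :
    ∀ᶠ N : ℕ in atTop, ∀ b : Circle →* Circle,
      ‖(N : ℂ)⁻¹ * ∑ n ∈ Finset.range N, (Psi E (tw (q * n + s) b) : ℂ)
        - ∑ w ∈ R, (corr E w : ℂ) * ((w ^ s * b w : Circle) : ℂ)‖ ≤ ε := by
  classical
  filter_upwards [psi_unif E 1 q s ε hε] with N hN b
  have h1 := hN b
  simp only [map_one, Circle.coe_one, mul_one] at h1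
  convert h1 using 3
  have h2 : ∀ x : Circle × Circle, (if (x.1 / x.2) ^ q = 1 then
      (((x.1 / x.2) ^ s * b (x.1 / x.2) : Circle) : ℂ) else 0) =
      ∑ w ∈ R, if x.1 / x.2 = w then ((w ^ s * b w : Circle) : ℂ) else 0 := by
    intro x
    rw [Finset.sum_ite_eq]
    simp only [hR]
  simp_rw [h2]
  rw [Finset.sum_comm, Finset.mul_sum]
  refine Finset.sum_congr rfl fun w _ => ?_
  rw [← Finset.sum_filter, Finset.sum_const, cntE, nsmul_eq_mul]
  unfold corr
  push_cast
  ring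

lemma psi_dev {E : Finset Circle} (hE : E.Nonempty) (w : Circle) (θ : ℝ) (hθ : 0 < θ) (hθ1 : θ ≤ 1)
    (hc : 1 - θ ^ 2 ≤ corr E w) :
    ∀ᶠ N : ℕ in atTop, ∀ b : Circle →* Circle,
      (N : ℝ)⁻¹ * ∑ n ∈ Finset.range N, Psi E (tw n b) * ‖(tw n b w : ℂ) - 1‖ ≤ 5 * θ := by
  have hθ2 : 0 < θ ^ 2 := by positivity
  filter_upwards [psi_unif_one hE (θ ^ 2) hθ2, psi_unif_corr E w (θ ^ 2) hθ2] with N h1 h2 b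
  have h1 := abs_le.1 (h1 b)
  have h2 := (Complex.abs_re_le_norm _).trans (h2 b)
  have h3 : ((N : ℂ)⁻¹ * ∑ n ∈ Finset.range N, (Psi E (tw n b) : ℂ) * (tw n b w : ℂ)
        - (corr E w : ℂ)).re = (N : ℝ)⁻¹ * ∑ n ∈ Finset.range N, Psi E (tw n b) * (tw n b w : ℂ).re
        - corr E w := by
    rw [Complex.sub_re, Complex.ofReal_re, ← Complex.ofReal_natCast, ← Complex.ofReal_inv,
      Complex.re_ofReal_mul, Complex.re_sum]
    simp only [Complex.re_ofReal_mul]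
  rw [h3] at h2
  have h2 := (abs_le.1 h2).1
  have hkey : ∀ c : Circle, ‖(c : ℂ) - 1‖ ≤ θ + θ⁻¹ * (1 - (c : ℂ).re) := by
    intro c
    have hc2 : ‖(c : ℂ) - 1‖ ^ 2 = 2 * (1 - (c : ℂ).re) := by
      have hn : (c : ℂ).re * (c : ℂ).re + (c : ℂ).im * (c : ℂ).im = 1 := by
        have := Circle.normSq_coe c
        rwa [Complex.normSq_apply] at this
      rw [← Complex.normSq_eq_norm_sq, Complex.normSq_apply]
      simp
      nlinarith
    have h4 : θ⁻¹ * (1 - (c : ℂ).re) = ‖(c : ℂ) - 1‖ ^ 2 / (2 * θ) := by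
      rw [hc2]; field_simp
    rw [h4, ← sub_nonneg]
    have : θ + ‖(c : ℂ) - 1‖ ^ 2 / (2 * θ) - ‖(c : ℂ) - 1‖ =
      ((‖(c : ℂ) - 1‖ - θ) ^ 2 + θ ^ 2) / (2 * θ) := by field_simp; ring
    rw [this]; positivity
  calc (N : ℝ)⁻¹ * ∑ n ∈ Finset.range N, Psi E (tw n b) * ‖(tw n b w : ℂ) - 1‖
      ≤ (N : ℝ)⁻¹ * ∑ n ∈ Finset.range N,
          Psi E (tw n b) * (θ + θ⁻¹ * (1 - (tw n b w : ℂ).re)) := by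
        gcongr with n _
        · exact Psi_nonneg _ _
        · exact hkey _
    _ = (θ + θ⁻¹) * ((N : ℝ)⁻¹ * ∑ n ∈ Finset.range N, Psi E (tw n b)) - θ⁻¹ *
        ((N : ℝ)⁻¹ * ∑ n ∈ Finset.range N, Psi E (tw n b) * (tw n b w : ℂ).re) := by
        simp only [Finset.mul_sum, ← Finset.sum_sub_distrib]
        refine Finset.sum_congr rfl fun n _ => by ring
    _ ≤ (θ + θ⁻¹) * (1 + θ ^ 2) - θ⁻¹ * (1 - 2 * θ ^ 2) := by
        gcongr <;> linarith
    _ = 4 * θ + θ ^ 3 := by field_simp; ring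
    _ ≤ 5 * θ := by nlinarith

end SumsetAux

namespace SumsetAux

/-- Abstract system. -/
structure Sys (ℓ m : ℕ) (Ω : Type) [MeasurableSpace Ω] where
  μ : Measure Ω
  ν : Measure Ω
  hμ : IsProbabilityMeasure μ
  hν : IsProbabilityMeasure ν
  T : Ω → Ω
  φ : Ω → Ω
  hTμ : MeasurePreserving T μ μ
  hTν : MeasurePreserving T ν ν
  hφ : Measurable φ
  hφT : ∀ p, φ (T p) = T^[ℓ] (φ p)
  hle : μ.map φ ≤ (ℓ : ENNReal) • ν
  z : Ω → (Circle →* Circle)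
  hz : ∀ χ, Measurable fun p => z p χ
  hzT : ∀ p χ, z (T p) χ = χ * z p χ

attribute [instance] Sys.hμ Sys.hν

variable {ℓ m : ℕ} {Ω : Type} [MeasurableSpace Ω] (Y : Sys ℓ m Ω)

lemma mp_int {X : Type*} [MeasurableSpace X] {μ : Measure X} {f : X → X} (hf : MeasurePreserving f μ μ)
    {F : Type*} [NormedAddCommGroup F] [NormedSpace ℝ F] {g : X → F}
    (hg : AEStronglyMeasurable g μ) : ∫ x, g (f x) ∂μ = ∫ x, g x ∂μ := by
  have h1 : AEStronglyMeasurable g (μ.map f) := by rw [hf.map_eq]; exact hg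
  rw [← integral_map hf.measurable.aemeasurable h1, hf.map_eq]

namespace Sys

lemma hT : Measurable Y.T := Y.hTμ.measurable

lemma zTn (k : ℕ) (p : Ω) (χ : Circle) : Y.z (Y.T^[k] p) χ = χ ^ k * Y.z p χ := by
  induction k with
  | zero => simp
  | succ k ih => rw [Function.iterate_succ_apply', Y.hzT, ih, pow_succ']; rw [mul_assoc]

lemma φTn (k : ℕ) (p : Ω) : Y.φ (Y.T^[k] p) = Y.T^[ℓ * k] (Y.φ p) := by
  induction k with
  | zero => simp
  | succ k ih =>
    rw [Function.iterate_succ_apply', Y.hφT, ih, ← Function.iterate_add_apply]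
    rw [Nat.mul_succ, Nat.add_comm]

/-- kernel -/
noncomputable def ker (E : Finset Circle) (n : ℕ) (p : Ω) : ℝ := Psi E (tw n (Y.z p)⁻¹)

lemma tw_shift (n k : ℕ) (p : Ω) :
    tw n (Y.z p)⁻¹ = tw (n + k) (Y.z (Y.T^[k] p))⁻¹ := by
  ext χ
  rw [tw_apply, tw_apply, MonoidHom.inv_apply, MonoidHom.inv_apply, Y.zTn, mul_inv, pow_add]
  congr 1
  rw [mul_assoc, mul_inv_cancel_left]

lemma ker_shift (E : Finset Circle) (n k : ℕ) (p : Ω) :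
    Y.ker E n p = Y.ker E (n + k) (Y.T^[k] p) := by
  unfold ker; rw [← tw_shift]

lemma ker_nonneg (E : Finset Circle) (n : ℕ) (p : Ω) : 0 ≤ Y.ker E n p := Psi_nonneg _ _

lemma ker_le (E : Finset Circle) (n : ℕ) (p : Ω) : Y.ker E n p ≤ E.card := Psi_le _ _

lemma circ_cont : Continuous (fun c : Circle => (c : ℂ)) := by fun_prop

lemma z_meas (χ : Circle) : Measurable fun p => ((Y.z p χ : Circle) : ℂ) :=
  circ_cont.measurable.comp (Y.hz χ)

lemma zi_meas (χ : Circle) : Measurable fun p => (((Y.z p χ)⁻¹ : Circle) : ℂ) :=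
  (circ_cont.comp continuous_inv).measurable.comp (Y.hz χ)

lemma ker_meas (E : Finset Circle) (n : ℕ) : Measurable (Y.ker E n) := by
  unfold ker Psi
  refine Measurable.const_mul (Measurable.pow_const (Measurable.norm ?_) 2) _
  refine Finset.measurable_fun_sum _ fun χ _ => ?_
  simp only [tw_apply, MonoidHom.inv_apply, Circle.coe_mul]
  exact (Y.zi_meas χ).const_mul _

lemma P_meas (k : ℕ) : Measurable fun p => Y.T^[k] (Y.φ p) :=
  (Y.hT.iterate k).comp Y.hφ

lemma P_le (k : ℕ) : Y.μ.map (fun p => Y.T^[k] (Y.φ p)) ≤ (ℓ : ENNReal) • Y.ν := by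
  have h1 : Y.μ.map (fun p => Y.T^[k] (Y.φ p)) = (Y.μ.map Y.φ).map Y.T^[k] :=
    (Measure.map_map (Y.hT.iterate k) Y.hφ).symm
  rw [h1]
  refine (Measure.map_mono Y.hle (Y.hT.iterate k)).trans ?_
  rw [Measure.map_smul, (Y.hTν.iterate k).map_eq]

lemma P_ae (k : ℕ) {Q : Ω → Prop} (h : ∀ᵐ y ∂Y.ν, Q y) : ∀ᵐ p ∂Y.μ, Q (Y.T^[k] (Y.φ p)) := by
  refine ae_of_ae_map (Y.P_meas k).aemeasurable ?_
  refine Measure.absolutelyContinuous_of_le (Y.P_le k) ?_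
  exact Measure.ae_smul_measure h _

lemma P_int {F : Type*} [NormedAddCommGroup F] (k : ℕ) {g : Ω → F} (hg : Integrable g Y.ν) :
    Integrable (fun p => g (Y.T^[k] (Y.φ p))) Y.μ := by
  have h1 : Integrable g (Y.μ.map (fun p => Y.T^[k] (Y.φ p))) :=
    (hg.smul_measure (c := (ℓ : ENNReal)) (by simp)).mono_measure (Y.P_le k)
  exact h1.comp_measurable (Y.P_meas k)

lemma P_le_int (k : ℕ) {g : Ω → ℝ} (hg : Integrable g Y.ν) (h0 : ∀ y, 0 ≤ g y) :
    ∫ p, g (Y.T^[k] (Y.φ p)) ∂Y.μ ≤ ℓ * ∫ y, g y ∂Y.ν := by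
  have h2 : Integrable g ((ℓ : ENNReal) • Y.ν) := hg.smul_measure (by simp)
  have h1 : Integrable g (Y.μ.map (fun p => Y.T^[k] (Y.φ p))) := h2.mono_measure (Y.P_le k)
  rw [← integral_map (Y.P_meas k).aemeasurable h1.aestronglyMeasurable]
  refine (integral_mono_measure (Y.P_le k) (Eventually.of_forall h0) h2).trans ?_
  rw [integral_smul_measure]; simp

/-- weights -/
def Wt (C : ℝ) (W : ℕ → Ω → ℝ) : Prop :=
  (∀ n p, 0 ≤ W n p ∧ W n p ≤ C) ∧ ∃ (r : ℕ) (v : Fin r → Ω → ℝ) (c : Fin r → ℕ → ℝ),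
    (∀ i, Measurable (v i)) ∧ (∀ i p, |v i p| ≤ C) ∧ (∀ i n, |c i n| ≤ 1) ∧
    ∀ n p, W n p = ∑ i, v i p * c i n

lemma Wt.meas {C : ℝ} {W : ℕ → Ω → ℝ} (hW : Wt C W) (n : ℕ) : Measurable (W n) := by
  obtain ⟨-, r, v, c, h1, -, -, h4⟩ := hW
  have : W n = fun p => ∑ i, v i p * c i n := funext (h4 n)
  rw [this]
  exact Finset.measurable_fun_sum _ fun i _ => (h1 i).mul_const _

/-- integrand -/
noncomputable def av (E : Finset Circle) (W : ℕ → Ω → ℝ) (k : Ω → ℂ) (M : ℕ) (p : Ω) : ℂ :=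
  (M : ℂ)⁻¹ * ∑ n ∈ Finset.range M, ((W n p * Y.ker E n p : ℝ) : ℂ) * k (Y.T^[m * n] (Y.φ p))

lemma av_int (E : Finset Circle) {C : ℝ} {W : ℕ → Ω → ℝ} (hW : Wt C W) {k : Ω → ℂ}
    (hk : Integrable k Y.ν) (M : ℕ) : Integrable (Y.av E W k M) Y.μ := by
  unfold av
  refine Integrable.const_mul (integrable_finsetSum _ fun n _ => ?_) _
  refine Integrable.bdd_mul (c := C * E.card) (Y.P_int _ hk) ?_ ?_
  · exact (Complex.measurable_ofReal.comp ((hW.meas n).mul (Y.ker_meas E n))).aestronglyMeasurable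
  · refine Eventually.of_forall fun p => ?_
    rw [Complex.norm_real, Real.norm_of_nonneg (mul_nonneg (hW.1 n p).1 (Y.ker_nonneg _ _ _))]
    exact mul_le_mul (hW.1 n p).2 (Y.ker_le _ _ _) (Y.ker_nonneg _ _ _)
      ((hW.1 n p).1.trans (hW.1 n p).2)

lemma wm_term (E : Finset Circle) {C : ℝ} {W : ℕ → Ω → ℝ} (hW : Wt C W) {fw : Ω → ℂ}
    (hfw : Integrable fw Y.ν) {a : ℕ → ℝ} (ha : Tendsto a atTop (𝓝 0))
    (h : ∀ (N : ℕ) (c : ℕ → ℂ), (∀ n, ‖c n‖ ≤ 1) →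
        ∫ y, ‖(N : ℂ)⁻¹ * ∑ n ∈ Finset.range N, c n * fw ((Y.T^[m])^[n] y)‖ ∂Y.ν ≤ a N) :
    Tendsto (fun M => ∫ p, Y.av E W fw M p ∂Y.μ) atTop (𝓝 0) := by
  obtain ⟨hW1, r, v, c, hv, hvC, hc, hWeq⟩ := id hW
  rcases Nat.eq_zero_or_pos r with hr | hr
  · subst hr
    have : ∀ M p, Y.av E W fw M p = 0 := by
      intro M p; unfold av; simp [hWeq]
    simp [this]
  have hC : 0 ≤ C := (abs_nonneg _).trans (hvC ⟨0, hr⟩ (Y.μ.nonempty_of_neZero.some))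
  let A : Fin r → Circle → ℕ → Ω → ℂ := fun i w M y =>
    (M : ℂ)⁻¹ * ∑ n ∈ Finset.range M, ((c i n : ℂ) * (w : ℂ) ^ n) * fw ((Y.T^[m])^[n] y)
  have hAint : ∀ i w M, Integrable (A i w M) Y.ν := by
    intro i w M
    refine Integrable.const_mul (integrable_finsetSum _ fun n _ => ?_) _
    refine Integrable.const_mul ?_ _
    exact ((Y.hTν.iterate m).iterate n).integrable_comp_of_integrable hfw
  have hA : ∀ i w M, ∫ p, ‖A i w M (Y.φ p)‖ ∂Y.μ ≤ ℓ * a M := by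
    intro i w M
    have h1 := Y.P_le_int 0 (hAint i w M).norm (fun _ => norm_nonneg _)
    simp only [Function.iterate_zero, id] at h1
    refine h1.trans ?_
    gcongr
    refine h M _ fun n => ?_
    rw [norm_mul, norm_pow, Circle.norm_coe, one_pow, mul_one, Complex.norm_real]
    exact hc i n
  have hpt : ∀ M p, ‖Y.av E W fw M p‖ ≤ ∑ i, ∑ x ∈ E ×ˢ E, C * ‖A i (x.1 / x.2) M (Y.φ p)‖ := by
    intro M p
    have h1 : Y.av E W fw M p = ∑ i, ∑ x ∈ E ×ˢ E, (E.card : ℂ)⁻¹ * (v i p : ℂ) *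
        (((Y.z p)⁻¹ (x.1 / x.2) : Circle) : ℂ) * A i (x.1 / x.2) M (Y.φ p) := by
      have h2 : ∀ n, ((W n p * Y.ker E n p : ℝ) : ℂ) * fw (Y.T^[m * n] (Y.φ p)) =
          ∑ i, ∑ x ∈ E ×ˢ E, ((E.card : ℂ)⁻¹ * (v i p : ℂ) *
            (((Y.z p)⁻¹ (x.1 / x.2) : Circle) : ℂ)) *
            (((c i n : ℂ) * ((x.1 / x.2 : Circle) : ℂ) ^ n) * fw ((Y.T^[m])^[n] (Y.φ p))) := by
        intro n
        simp only [ker, Complex.ofReal_mul, Psi_eq, hWeq, tw_apply, Complex.ofReal_sum,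
          Finset.mul_sum, Finset.sum_mul, Circle.coe_mul, Circle.coe_pow]
        refine Finset.sum_congr rfl fun i _ => Finset.sum_congr rfl fun x _ => ?_
        rw [Function.iterate_mul]
        ring
      unfold av
      simp_rw [h2]
      rw [Finset.sum_comm, Finset.mul_sum]
      refine Finset.sum_congr rfl fun i _ => ?_
      rw [Finset.sum_comm, Finset.mul_sum]
      refine Finset.sum_congr rfl fun x _ => ?_
      rw [← Finset.mul_sum]
      simp only [A]
      ring
    rw [h1]
    refine (norm_sum_le _ _).trans (Finset.sum_le_sum fun i _ => ?_)
    refine (norm_sum_le _ _).trans (Finset.sum_le_sum fun x hx => ?_)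
    rw [norm_mul]
    gcongr
    rw [norm_mul, norm_mul, Circle.norm_coe, mul_one, norm_inv, Complex.norm_natCast,
      Complex.norm_real]
    have h3 : (1 : ℝ) ≤ E.card := by
      exact_mod_cast Finset.card_pos.2 ⟨x.1, (Finset.mem_product.1 hx).1⟩
    have h4 : (E.card : ℝ)⁻¹ ≤ 1 := inv_le_one_of_one_le₀ h3
    calc (E.card : ℝ)⁻¹ * ‖v i p‖ ≤ 1 * C := by
          gcongr; exact hvC i p
      _ = C := one_mul _
  rw [tendsto_zero_iff_norm_tendsto_zero]
  have hlim : Tendsto (fun M => ∑ _i : Fin r, ∑ x ∈ E ×ˢ E, C * (ℓ * a M)) atTop (𝓝 0) := by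
    have : Tendsto (fun M => ∑ _i : Fin r, ∑ x ∈ E ×ˢ E, C * (ℓ * a M)) atTop
        (𝓝 (∑ _i : Fin r, ∑ x ∈ E ×ˢ E, C * (ℓ * 0))) :=
      tendsto_finsetSum _ fun i _ => tendsto_finsetSum _ fun x _ => (ha.const_mul _).const_mul _
    simpa using this
  refine squeeze_zero (fun _ => norm_nonneg _) (fun M => ?_) hlim
  refine (norm_integral_le_integral_norm _).trans ?_
  have hI : ∀ i, ∀ x : Circle × Circle,
      Integrable (fun p => C * ‖A i (x.1 / x.2) M (Y.φ p)‖) Y.μ := by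
    intro i x
    have := Y.P_int 0 (hAint i (x.1 / x.2) M).norm
    simp only [Function.iterate_zero, id] at this
    exact this.const_mul _
  refine (integral_mono (Y.av_int E hW hfw M).norm
    (integrable_finsetSum _ fun i _ => integrable_finsetSum _ fun x _ => hI i x)
    (hpt M)).trans ?_
  rw [integral_finsetSum _ fun i _ => integrable_finsetSum _ fun x _ => hI i x]
  refine Finset.sum_le_sum fun i _ => ?_
  rw [integral_finsetSum _ fun x _ => hI i x]
  refine Finset.sum_le_sum fun x _ => ?_
  rw [integral_const_mul]
  exact mul_le_mul_of_nonneg_left (hA _ _ _) hC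

end Sys

end SumsetAux

namespace SumsetAux
variable {ℓ m : ℕ} {Ω : Type} [MeasurableSpace Ω] (Y : Sys ℓ m Ω)
namespace Sys

lemma kg_int (E : Finset Circle) (n k : ℕ) {g : Ω → ℝ} (hg : Integrable g Y.ν) :
    Integrable (fun p => Y.ker E n p * g (Y.T^[k] (Y.φ p))) Y.μ := by
  refine Integrable.bdd_mul (c := E.card) (Y.P_int _ hg) (Y.ker_meas E n).aestronglyMeasurable ?_
  refine Eventually.of_forall fun p => ?_
  rw [Real.norm_of_nonneg (Y.ker_nonneg _ _ _)]
  exact Y.ker_le _ _ _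

/-- change of variables -/
lemma kg_shift (E : Finset Circle) (n' s : ℕ) {g : Ω → ℝ} (hg : Integrable g Y.ν) :
    ∫ p, Y.ker E (ℓ * n' + s) p * g (Y.T^[m * (ℓ * n' + s)] (Y.φ p)) ∂Y.μ =
    ∫ p, Y.ker E ((ℓ + m) * n' + s) p * g (Y.T^[m * s] (Y.φ p)) ∂Y.μ := by
  have h := mp_int (Y.hTμ.iterate (m * n'))
    (Y.kg_int E ((ℓ + m) * n' + s) (m * s) hg).aestronglyMeasurable
  rw [← h]
  refine integral_congr_ae (Eventually.of_forall fun p => ?_)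
  simp only
  rw [Y.ker_shift E (ℓ * n' + s) (m * n'), Y.φTn, ← Function.iterate_add_apply,
    show ℓ * n' + s + m * n' = (ℓ + m) * n' + s by ring,
    show m * s + ℓ * (m * n') = m * (ℓ * n' + s) by ring]

lemma sum_divmod_le (hℓ : 0 < ℓ) (J : ℕ → ℕ → ℝ) (hJ : ∀ a b, 0 ≤ J a b) (M : ℕ) :
    ∑ n ∈ Finset.range M, J (n / ℓ) (n % ℓ) ≤ ∑ s ∈ Finset.range ℓ, ∑ n' ∈ Finset.range M, J n' s := by
  rw [← Finset.sum_product']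
  rw [← Finset.sum_image (s := Finset.range M) (f := fun x : ℕ × ℕ => J x.2 x.1)
    (g := fun n => (n % ℓ, n / ℓ))]
  · refine Finset.sum_le_sum_of_subset_of_nonneg ?_ fun _ _ _ => hJ _ _
    rintro ⟨a, b⟩ h
    simp only [Finset.mem_image, Finset.mem_range, Prod.mk.injEq, Finset.mem_product] at h ⊢
    obtain ⟨n, hn, rfl, rfl⟩ := h
    exact ⟨Nat.mod_lt _ hℓ, (Nat.div_le_self _ _).trans_lt hn⟩
  · intro a _ b _ h
    simp only [Prod.mk.injEq] at h
    rw [← Nat.div_add_mod a ℓ, ← Nat.div_add_mod b ℓ, h.1, h.2]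

lemma sum_arith_le (q s : ℕ) (hs : s < q) (J : ℕ → ℝ) (hJ : ∀ a, 0 ≤ J a) (M : ℕ) :
    ∑ n ∈ Finset.range M, J (q * n + s) ≤ ∑ n ∈ Finset.range (q * M), J n := by
  rw [← Finset.sum_image (s := Finset.range M) (f := J) (g := fun n => q * n + s)]
  · refine Finset.sum_le_sum_of_subset_of_nonneg ?_ fun _ _ _ => hJ _
    intro a h
    simp only [Finset.mem_image, Finset.mem_range] at h ⊢
    obtain ⟨n, hn, rfl⟩ := h
    calc q * n + s < q * n + q := by omega
      _ = q * (n + 1) := by ring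
      _ ≤ q * M := Nat.mul_le_mul_left _ hn
  · intro a _ b _ h
    simp only at h
    have : q * a = q * b := by omega
    exact Nat.eq_of_mul_eq_mul_left (by omega) this

lemma tail_term (hℓ : 0 < ℓ) (hm : 0 < m) {E : Finset Circle} (hE : E.Nonempty) : ∀ᶠ M : ℕ in atTop,
    ∀ g : Ω → ℝ, (∀ y, 0 ≤ g y) → Integrable g Y.ν →
      (M : ℝ)⁻¹ * ∑ n ∈ Finset.range M, ∫ p, Y.ker E n p * g (Y.T^[m * n] (Y.φ p)) ∂Y.μ ≤
        2 * (ℓ + m) * ℓ ^ 2 * ∫ y, g y ∂Y.ν := by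
  have h1 := (tendsto_id.const_mul_atTop' (show 0 < ℓ + m by omega)).eventually
    (psi_unif_one hE 1 one_pos)
  filter_upwards [h1, eventually_gt_atTop 0] with M hM hM0 g hg0 hg
  simp only [id] at hM
  have hMr : (0 : ℝ) < M := by exact_mod_cast hM0
  have hq : (0 : ℝ) < ℓ + m := by have : (0 : ℝ) < ℓ := by exact_mod_cast hℓ
                                  positivity
  have hb : ∀ p, ∑ n ∈ Finset.range ((ℓ + m) * M), Y.ker E n p ≤ 2 * (ℓ + m) * M := by
    intro p
    have h2 := (abs_le.1 (hM (Y.z p)⁻¹)).2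
    have h3 : (((ℓ + m) * M : ℕ) : ℝ)⁻¹ * ∑ n ∈ Finset.range ((ℓ + m) * M), Y.ker E n p ≤ 2 := by
      unfold ker; linarith
    rw [inv_mul_le_iff₀ (by push_cast; positivity)] at h3
    push_cast at h3
    linarith
  have h2 : ∑ n ∈ Finset.range M, ∫ p, Y.ker E n p * g (Y.T^[m * n] (Y.φ p)) ∂Y.μ ≤
      ∑ s ∈ Finset.range ℓ, ∑ n' ∈ Finset.range M,
        ∫ p, Y.ker E ((ℓ + m) * n' + s) p * g (Y.T^[m * s] (Y.φ p)) ∂Y.μ := by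
    refine le_trans (le_of_eq ?_) (sum_divmod_le hℓ (fun n' s =>
      ∫ p, Y.ker E ((ℓ + m) * n' + s) p * g (Y.T^[m * s] (Y.φ p)) ∂Y.μ) ?_ M)
    · refine Finset.sum_congr rfl fun n _ => ?_
      rw [← Y.kg_shift E _ _ hg, Nat.div_add_mod]
    · intro a b
      exact integral_nonneg fun p => mul_nonneg (Y.ker_nonneg _ _ _) (hg0 _)
  have h3 : ∀ s ∈ Finset.range ℓ, ∑ n' ∈ Finset.range M,
        ∫ p, Y.ker E ((ℓ + m) * n' + s) p * g (Y.T^[m * s] (Y.φ p)) ∂Y.μ ≤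
        2 * (ℓ + m) * M * (ℓ * ∫ y, g y ∂Y.ν) := by
    intro s hs
    rw [← integral_finsetSum _ fun n' _ => Y.kg_int E _ _ hg]
    have h4 : ∀ p, ∑ n' ∈ Finset.range M, Y.ker E ((ℓ + m) * n' + s) p * g (Y.T^[m * s] (Y.φ p))
        ≤ 2 * (ℓ + m) * M * g (Y.T^[m * s] (Y.φ p)) := by
      intro p
      rw [← Finset.sum_mul]
      refine mul_le_mul_of_nonneg_right ?_ (hg0 _)
      refine le_trans (sum_arith_le (ℓ + m) s ?_ (fun n => Y.ker E n p)
        (fun n => Y.ker_nonneg _ _ _) M) (hb p)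
      have := Finset.mem_range.1 hs; omega
    refine (integral_mono (integrable_finsetSum _ fun n' _ => Y.kg_int E _ _ hg)
      ((Y.P_int _ hg).const_mul _) h4).trans ?_
    rw [integral_const_mul]
    exact mul_le_mul_of_nonneg_left (Y.P_le_int _ hg hg0) (by positivity)
  have h5 := h2.trans (Finset.sum_le_sum h3)
  rw [Finset.sum_const, Finset.card_range, nsmul_eq_mul] at h5
  rw [inv_mul_le_iff₀ hMr]
  refine h5.trans (le_of_eq ?_)
  ring

lemma tail_term' {E : Finset Circle} {C : ℝ} {W : ℕ → Ω → ℝ} (hW : Wt C W) 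
    {ft : Ω → ℂ} (hft : Integrable ft Y.ν) (M : ℕ) :
    ‖∫ p, Y.av E W ft M p ∂Y.μ‖ ≤ C * ((M : ℝ)⁻¹ * ∑ n ∈ Finset.range M,
      ∫ p, Y.ker E n p * ‖ft (Y.T^[m * n] (Y.φ p))‖ ∂Y.μ) := by
  refine (norm_integral_le_integral_norm _).trans ?_
  have hI : ∀ n, Integrable (fun p => Y.ker E n p * ‖ft (Y.T^[m * n] (Y.φ p))‖) Y.μ :=
    fun n => Y.kg_int E n (m * n) hft.norm
  rw [← integral_finsetSum _ fun n _ => hI n, ← integral_const_mul, ← integral_const_mul]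
  refine integral_mono (Y.av_int E hW hft M).norm
    (((integrable_finsetSum _ fun n _ => hI n).const_mul _).const_mul _) fun p => ?_
  simp only
  unfold av
  rw [norm_mul, norm_inv, Complex.norm_natCast, mul_left_comm]
  gcongr
  refine (norm_sum_le _ _).trans ?_
  rw [Finset.mul_sum]
  refine Finset.sum_le_sum fun n _ => ?_
  rw [norm_mul, Complex.norm_real, Real.norm_of_nonneg (mul_nonneg (hW.1 n p).1 (Y.ker_nonneg _ _ _)),
    mul_assoc]
  exact mul_le_mul_of_nonneg_right (hW.1 n p).2
    (mul_nonneg (Y.ker_nonneg _ _ _) (norm_nonneg _))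

lemma eig_ae {g : Ω → ℂ} {w : Circle} (hg : ∀ᵐ y ∂Y.ν, g (Y.T^[m] y) = w * g y) :
    ∀ᵐ p ∂Y.μ, ∀ n, g (Y.T^[m * n] (Y.φ p)) = (w : ℂ) ^ n * g (Y.φ p) := by
  have h1 : ∀ᵐ p ∂Y.μ, ∀ n, g (Y.T^[m] (Y.T^[m * n] (Y.φ p))) = w * g (Y.T^[m * n] (Y.φ p)) := by
    rw [ae_all_iff]
    intro n
    exact Y.P_ae (m * n) hg
  filter_upwards [h1] with p hp n
  induction n with
  | zero => simp
  | succ n ih =>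
    have := hp n
    rw [← Function.iterate_add_apply, ih] at this
    rw [show m * (n + 1) = m + m * n by ring, this, pow_succ']
    ring

lemma eig_term {E : Finset Circle} {C : ℝ} {W : ℕ → Ω → ℝ} (hW : Wt C W)
    {g : Ω → ℂ} {w : Circle} (hgi : Integrable g Y.ν)
    (hg : ∀ᵐ y ∂Y.ν, g (Y.T^[m] y) = w * g y) (M : ℕ) (θ ε' : ℝ) 
    (h5 : ∀ b : Circle →* Circle,
      (M : ℝ)⁻¹ * ∑ n ∈ Finset.range M, Psi E (tw n b) * ‖(tw n b w : ℂ) - 1‖ ≤ 5 * θ)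
    (h6 : ∀ p, |(M : ℝ)⁻¹ * ∑ n ∈ Finset.range M, W n p * Y.ker E n p - 1| ≤ ε') :
    ‖∫ p, Y.av E W g M p ∂Y.μ - ∫ p, (Y.z p w : ℂ) * g (Y.φ p) ∂Y.μ‖ ≤
      (C * (5 * θ) + ε') * (ℓ * ∫ y, ‖g y‖ ∂Y.ν) := by
  have hP0 := Y.P_int 0 hgi
  have hP1 := Y.P_le_int 0 hgi.norm (fun _ => norm_nonneg _)
  simp only [Function.iterate_zero, id] at hP0 hP1
  have hzi : Integrable (fun p => (Y.z p w : ℂ) * g (Y.φ p)) Y.μ := by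
    refine hP0.bdd_mul (c := 1) (Y.z_meas w).aestronglyMeasurable
      (Eventually.of_forall fun p => ?_)
    rw [Circle.norm_coe]
  have p0 : Ω := Y.μ.nonempty_of_neZero.some
  have hC : 0 ≤ C := (hW.1 0 p0).1.trans (hW.1 0 p0).2
  have hcoef : 0 ≤ C * (5 * θ) + ε' := by
    have h7 := (abs_nonneg _).trans (h6 p0)
    have h8 : 0 ≤ 5 * θ := le_trans (mul_nonneg (by positivity) (Finset.sum_nonneg fun n _ =>
      mul_nonneg (Psi_nonneg _ _) (norm_nonneg _))) (h5 1)
    positivity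
  rw [← integral_sub (Y.av_int E hW hgi M) hzi]
  refine (norm_integral_le_integral_norm _).trans ?_
  refine le_trans ?_ (mul_le_mul_of_nonneg_left hP1 hcoef)
  rw [← integral_const_mul]
  refine integral_mono_ae ((Y.av_int E hW hgi M).sub hzi).norm (hP0.norm.const_mul _) ?_
  filter_upwards [Y.eig_ae hg] with p hp
  have hzz : (Y.z p w : ℂ) * (((Y.z p w)⁻¹ : Circle) : ℂ) = 1 := by
    rw [← Circle.coe_mul, mul_inv_cancel, Circle.coe_one]
  have h1 : Y.av E W g M p - (Y.z p w : ℂ) * g (Y.φ p) =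
      ((Y.z p w : ℂ) * g (Y.φ p)) * ((M : ℂ)⁻¹ * ∑ n ∈ Finset.range M,
        ((W n p * Y.ker E n p : ℝ) : ℂ) * ((tw n (Y.z p)⁻¹ w : ℂ) - 1) +
        (((M : ℝ)⁻¹ * ∑ n ∈ Finset.range M, W n p * Y.ker E n p - 1 : ℝ) : ℂ)) := by
    have h2 : ∑ n ∈ Finset.range M, ((W n p * Y.ker E n p : ℝ) : ℂ) * ((tw n (Y.z p)⁻¹ w : ℂ) - 1)
        = ∑ n ∈ Finset.range M, ((W n p * Y.ker E n p : ℝ) : ℂ) * (tw n (Y.z p)⁻¹ w : ℂ) -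
          ((∑ n ∈ Finset.range M, W n p * Y.ker E n p : ℝ) : ℂ) := by
      rw [Complex.ofReal_sum, ← Finset.sum_sub_distrib]
      exact Finset.sum_congr rfl fun n _ => by ring
    have h3 : ∑ n ∈ Finset.range M, ((W n p * Y.ker E n p : ℝ) : ℂ) * g (Y.T^[m * n] (Y.φ p)) =
        ((Y.z p w : ℂ) * g (Y.φ p)) *
        ∑ n ∈ Finset.range M, ((W n p * Y.ker E n p : ℝ) : ℂ) * (tw n (Y.z p)⁻¹ w : ℂ) := by
      rw [Finset.mul_sum]
      refine Finset.sum_congr rfl fun n _ => ?_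
      rw [hp n, tw_apply, MonoidHom.inv_apply, Circle.coe_mul, Circle.coe_pow]
      linear_combination (-(((W n p * Y.ker E n p : ℝ) : ℂ) * (w : ℂ) ^ n * g (Y.φ p))) * hzz
    unfold av
    rw [h3, h2, Complex.ofReal_sub, Complex.ofReal_mul, Complex.ofReal_inv, Complex.ofReal_natCast,
      Complex.ofReal_one]
    ring
  rw [h1, norm_mul, norm_mul, Circle.norm_coe, one_mul, mul_comm]
  refine mul_le_mul_of_nonneg_right ?_ (norm_nonneg _)
  refine (norm_add_le _ _).trans (add_le_add ?_ ?_)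
  · rw [norm_mul, norm_inv, Complex.norm_natCast]
    refine le_trans ?_ (mul_le_mul_of_nonneg_left (h5 (Y.z p)⁻¹) hC)
    rw [mul_left_comm]
    gcongr
    refine (norm_sum_le _ _).trans ?_
    rw [Finset.mul_sum]
    refine Finset.sum_le_sum fun n _ => ?_
    rw [norm_mul, Complex.norm_real,
      Real.norm_of_nonneg (mul_nonneg (hW.1 n p).1 (Y.ker_nonneg _ _ _)), mul_assoc]
    exact mul_le_mul_of_nonneg_right (hW.1 n p).2
      (mul_nonneg (Psi_nonneg _ _) (norm_nonneg _))
  · rw [Complex.norm_real]; exact h6 p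

end Sys
end SumsetAux

namespace SumsetAux
variable {ℓ m : ℕ} {Ω : Type} [MeasurableSpace Ω] (Y : Sys ℓ m Ω)
namespace Sys

lemma folner_corr (Λ : Finset Circle) (κ : ℝ) (hκ : 0 < κ) :
    ∃ E : Finset Circle, E.Nonempty ∧ ∀ w ∈ Λ, 1 - κ ≤ corr E w := by
  obtain ⟨E, hE, h⟩ := folner Λ κ hκ
  refine ⟨E, hE, fun w hw => ?_⟩
  have h1 := h w hw
  have h0 : (0 : ℝ) < E.card := by exact_mod_cast hE.card_pos
  unfold corr
  rw [le_inv_mul_iff₀ h0]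
  linarith

lemma core_tau (hℓ : 0 < ℓ) (hm : 0 < m) (R : Finset Circle) (κ₀ : ℝ) (hκ₀ : 0 < κ₀)
    (f : Ω → ℂ) (hf : Measurable f) (hf1 : ∀ y, ‖f y‖ ≤ 1) (C ε : ℝ) (hC : 1 ≤ C) (hε : 0 < ε) :
    ∃ (E : Finset Circle) (τ : ℂ), E.Nonempty ∧ (∀ w ∈ R, 1 - κ₀ ≤ corr E w) ∧
      ∀ l : Filter ℕ, l ≤ atTop → ∀ W : ℕ → Ω → ℝ, Wt C W →
      (∀ ε' > 0, ∀ᶠ M : ℕ in l, ∀ p,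
        |(M : ℝ)⁻¹ * ∑ n ∈ Finset.range M, W n p * Y.ker E n p - 1| ≤ ε') →
      ∀ᶠ M : ℕ in l, ‖∫ p, Y.av E W f M p ∂Y.μ - τ‖ ≤ ε := by
  classical
  have hℓr : (0 : ℝ) < ℓ := by exact_mod_cast hℓ
  have hmr : (0 : ℝ) < m := by exact_mod_cast hm
  have hC0 : 0 < C := by linarith
  set K : ℝ := 2 * (ℓ + m) * ℓ ^ 2 with hK
  have hK0 : 0 < K := by positivity
  have hfL : MemLp f 2 Y.ν := 
    MemLp.of_bound hf.aestronglyMeasurable 1 (Eventually.of_forall hf1)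
  obtain ⟨k, lam, g, fw, ft, a, -, hgi, hge, -, hfwi, -, hfti, hftη, hdec, ha, hwm⟩ :=
    decomp Y.ν Y.T^[m] (Y.hTν.iterate m) f hfL (ε / (4 * C * K)) (by positivity)
  set G : ℝ := ∑ i, ∫ y, ‖g i y‖ ∂Y.ν with hG
  have hG0 : 0 ≤ G := Finset.sum_nonneg fun i _ => integral_nonneg fun y => norm_nonneg _
  set θ : ℝ := min 1 (ε / (20 * C * ℓ * (G + 1))) with hθ
  have hθ0 : 0 < θ := lt_min one_pos (by positivity)
  obtain ⟨E, hE, hEc⟩ := folner_corr (Finset.univ.image lam ∪ R) (min (θ ^ 2) κ₀)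
    (lt_min (by positivity) hκ₀)
  refine ⟨E, ∑ i, ∫ p, (Y.z p (lam i) : ℂ) * g i (Y.φ p) ∂Y.μ, hE, fun w hw => ?_, ?_⟩
  · have := hEc w (Finset.mem_union_right _ hw)
    have h2 := min_le_right (θ ^ 2) κ₀
    linarith
  intro l hl W hW hW2
  have hcorr : ∀ i, 1 - θ ^ 2 ≤ corr E (lam i) := by
    intro i
    have := hEc (lam i) (Finset.mem_union_left _ (Finset.mem_image_of_mem _ (Finset.mem_univ i)))
    have h2 := min_le_left (θ ^ 2) κ₀
    linarith
  have e1 : ∀ᶠ M : ℕ in l, ‖∫ p, Y.av E W fw M p ∂Y.μ‖ < ε / 4 := by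
    have := (Y.wm_term E hW hfwi ha hwm).norm
    rw [norm_zero] at this
    exact (this.mono_left hl).eventually_lt_const (by positivity)
  have e2 := hl (Y.tail_term hℓ hm hE)
  have e3 : ∀ᶠ M : ℕ in l, ∀ i ∈ (Finset.univ : Finset (Fin k)), ∀ b : Circle →* Circle,
      (M : ℝ)⁻¹ * ∑ n ∈ Finset.range M, Psi E (tw n b) * ‖(tw n b (lam i) : ℂ) - 1‖ ≤ 5 * θ := by
    rw [Filter.eventually_all_finset]
    intro i _
    exact hl (psi_dev hE (lam i) θ hθ0 (min_le_left _ _) (hcorr i))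
  have e4 := hW2 (ε / (4 * ℓ * (G + 1))) (by positivity)
  filter_upwards [e1, e2, e3, e4] with M e1 e2 e3 e4
  have hfi : Integrable f Y.ν := hfL.integrable (by norm_num)
  have hlin : ∫ p, Y.av E W f M p ∂Y.μ = ∫ p, Y.av E W fw M p ∂Y.μ + ∫ p, Y.av E W ft M p ∂Y.μ +
      ∑ i, ∫ p, Y.av E W (g i) M p ∂Y.μ := by
    have hadd : Integrable (fun p => Y.av E W fw M p + Y.av E W ft M p) Y.μ :=
      (Y.av_int E hW hfwi M).add (Y.av_int E hW hfti M)
    rw [← integral_finsetSum _ fun i _ => Y.av_int E hW (hgi i) M,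
      ← integral_add (Y.av_int E hW hfwi M) (Y.av_int E hW hfti M),
      ← integral_add hadd
        (integrable_finsetSum _ fun i _ => Y.av_int E hW (hgi i) M)]
    refine integral_congr_ae ?_
    have h1 : ∀ᵐ p ∂Y.μ, ∀ n, f (Y.T^[m * n] (Y.φ p)) = fw (Y.T^[m * n] (Y.φ p)) +
        ft (Y.T^[m * n] (Y.φ p)) + ∑ i, g i (Y.T^[m * n] (Y.φ p)) := by
      rw [ae_all_iff]; intro n; exact Y.P_ae (m * n) hdec
    filter_upwards [h1] with p hp
    unfold av
    simp only [hp]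
    rw [← Finset.mul_sum, ← mul_add, ← mul_add, Finset.sum_comm, ← Finset.sum_add_distrib,
      ← Finset.sum_add_distrib]
    congr 1
    refine Finset.sum_congr rfl fun n _ => ?_
    rw [← Finset.mul_sum]
    ring
  have t2 : ‖∫ p, Y.av E W ft M p ∂Y.μ‖ ≤ ε / 4 := by
    refine (Y.tail_term' hW hfti M).trans ?_
    have h1 := e2 (fun y => ‖ft y‖) (fun y => norm_nonneg _) hfti.norm
    calc _ ≤ C * (K * ∫ y, ‖ft y‖ ∂Y.ν) := by gcongr
      _ ≤ C * (K * (ε / (4 * C * K))) := by gcongr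
      _ = ε / 4 := by field_simp
  have t3 : ‖∑ i, ∫ p, Y.av E W (g i) M p ∂Y.μ - ∑ i, ∫ p, (Y.z p (lam i) : ℂ) * g i (Y.φ p) ∂Y.μ‖
      ≤ ε / 2 := by
    rw [← Finset.sum_sub_distrib]
    refine (norm_sum_le _ _).trans ?_
    refine (Finset.sum_le_sum fun i hi => Y.eig_term hW (hgi i) (hge i) M θ
      (ε / (4 * ℓ * (G + 1))) (e3 i hi) e4).trans ?_
    rw [← Finset.mul_sum, ← Finset.mul_sum, ← hG]
    have h1 : θ ≤ ε / (20 * C * ℓ * (G + 1)) := min_le_right _ _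
    calc (C * (5 * θ) + ε / (4 * ℓ * (G + 1))) * (ℓ * G) 
        ≤ (C * (5 * (ε / (20 * C * ℓ * (G + 1)))) + ε / (4 * ℓ * (G + 1))) * (ℓ * (G + 1)) := by
          gcongr; linarith
      _ = ε / 2 := by field_simp; norm_num
  rw [hlin]
  calc _ = ‖∫ p, Y.av E W fw M p ∂Y.μ + ∫ p, Y.av E W ft M p ∂Y.μ +
        (∑ i, ∫ p, Y.av E W (g i) M p ∂Y.μ - ∑ i, ∫ p, (Y.z p (lam i) : ℂ) * g i (Y.φ p) ∂Y.μ)‖ := by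
        congr 1; ring
    _ ≤ ε / 4 + ε / 4 + ε / 2 := by
        refine (norm_add_le _ _).trans (add_le_add ((norm_add_le _ _).trans (add_le_add e1.le t2)) t3)
    _ = ε := by ring

end Sys
end SumsetAux

namespace SumsetAux
variable {ℓ m : ℕ} {Ω : Type} [MeasurableSpace Ω] (Y : Sys ℓ m Ω)
namespace Sys

lemma sum_range_mul_split {F : Type*} [AddCommMonoid F] (l N : ℕ) (g : ℕ → F) :
    ∑ n ∈ Finset.range (l * N), g n = ∑ s ∈ Finset.range l, ∑ n ∈ Finset.range N, g (l * n + s) := by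
  induction N with
  | zero => simp
  | succ N ih =>
    rw [Nat.mul_succ, Finset.sum_range_add, ih, ← Finset.sum_add_distrib]
    refine Finset.sum_congr rfl fun s _ => ?_
    rw [Finset.sum_range_succ]

/-- residue weight -/
noncomputable def rw' (R : Finset Circle) (s : ℕ) (p : Ω) : ℂ :=
  ∑ w ∈ R, ((w ^ s * (Y.z p w)⁻¹ : Circle) : ℂ)

/-- the limit value -/
noncomputable def beta (R : Finset Circle) (f : Ω → ℝ) : ℂ :=
  (ℓ : ℂ)⁻¹ * ∑ s ∈ Finset.range ℓ, ∫ p, Y.rw' R s p * (f (Y.T^[m * s] (Y.φ p)) : ℂ) ∂Y.μ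

lemma rw_meas (R : Finset Circle) (s : ℕ) : Measurable (Y.rw' R s) := by
  unfold rw'
  refine Finset.measurable_fun_sum _ fun w _ => ?_
  simp only [Circle.coe_mul]
  exact (Y.zi_meas w).const_mul _

lemma rw_norm (R : Finset Circle) (s : ℕ) (p : Ω) : ‖Y.rw' R s p‖ ≤ R.card := by
  unfold rw'
  refine (norm_sum_le _ _).trans ?_
  simp only [Circle.norm_coe]
  simp

lemma core1 (hℓ : 0 < ℓ) (hm : 0 < m) (R : Finset Circle) (hR : ∀ w, w ∈ R ↔ w ^ (ℓ + m) = 1)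
    (f : Ω → ℝ) (hf : Measurable f) (hf0 : ∀ y, 0 ≤ f y) (hf1 : ∀ y, f y ≤ 1)
    (C ε : ℝ) (hC : 1 ≤ C) (hε : 0 < ε) :
    ∃ E : Finset Circle, E.Nonempty ∧
      ∀ l : Filter ℕ, l ≤ atTop → ∀ W : ℕ → Ω → ℝ, Wt C W →
      (∀ ε' > 0, ∀ᶠ M : ℕ in l, ∀ p,
        |(M : ℝ)⁻¹ * ∑ n ∈ Finset.range M, W n p * Y.ker E n p - 1| ≤ ε') →
      ∀ᶠ M : ℕ in l, ‖∫ p, Y.av E W (fun y => (f y : ℂ)) M p ∂Y.μ - Y.beta R f‖ ≤ ε := by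
  have hfn : ∀ y, ‖(f y : ℂ)‖ ≤ 1 := fun y => by
    rw [Complex.norm_real, Real.norm_of_nonneg (hf0 y)]; exact hf1 y
  have hfm : Measurable fun y => (f y : ℂ) := Complex.measurable_ofReal.comp hf
  have hfi : Integrable f Y.ν := Integrable.of_bound hf.aestronglyMeasurable 1
    (Eventually.of_forall fun y => by rw [Real.norm_of_nonneg (hf0 y)]; exact hf1 y)
  have hℓr : (0 : ℝ) < ℓ := by exact_mod_cast hℓ
  obtain ⟨E, τ, hE, hEc, hmain⟩ := Y.core_tau hℓ hm R (ε / (4 * (R.card + 1))) (by positivity)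
    (fun y => (f y : ℂ)) hfm hfn C (ε / 4) hC (by positivity)
  refine ⟨E, hE, fun l hl W hW hW2 => ?_⟩
  suffices hτ : ‖τ - Y.beta R f‖ ≤ 3 * ε / 4 by
    filter_upwards [hmain l hl W hW hW2] with M hM
    calc _ = ‖(∫ p, Y.av E W (fun y => (f y : ℂ)) M p ∂Y.μ - τ) + (τ - Y.beta R f)‖ := by
          congr 1; ring
      _ ≤ ε / 4 + 3 * ε / 4 := (norm_add_le _ _).trans (add_le_add hM hτ)
      _ = ε := by ring
  have hW1 : Wt C (fun (_ : ℕ) (_ : Ω) => (1 : ℝ)) := by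
    refine ⟨fun n p => ⟨by norm_num, hC⟩, 1, fun _ _ => 1, fun _ _ => 1, fun _ => measurable_const,
      fun _ _ => by simpa using hC, fun _ _ => by simp, fun n p => by simp⟩
  have h1 := hmain atTop le_rfl (fun _ _ => 1) hW1 (by
    intro ε' hε'
    filter_upwards [psi_unif_one hE ε' hε'] with M hM p
    simpa [ker] using hM (Y.z p)⁻¹)
  have h1' := (tendsto_id.const_mul_atTop' hℓ).eventually h1
  have h2 : ∀ᶠ N : ℕ in atTop, ∀ s ∈ Finset.range ℓ, ∀ b : Circle →* Circle,
      ‖(N : ℂ)⁻¹ * ∑ n ∈ Finset.range N, (Psi E (tw ((ℓ + m) * n + s) b) : ℂ) -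
        ∑ w ∈ R, (corr E w : ℂ) * ((w ^ s * b w : Circle) : ℂ)‖ ≤ ε / 4 := by
    rw [Filter.eventually_all_finset]
    intro s _
    exact psi_unif_res E (ℓ + m) s R hR (ε / 4) (by positivity)
  obtain ⟨N, hN1, hN2, hN0⟩ := (h1'.and (h2.and (eventually_gt_atTop 0))).exists
  simp only [id] at hN1
  have hNr : (0 : ℝ) < N := by exact_mod_cast hN0
  have hNc : (N : ℂ) ≠ 0 := by exact_mod_cast hN0.ne'
  have hℓc : (ℓ : ℂ) ≠ 0 := by exact_mod_cast hℓ.ne'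
  have hInteg : ∀ s n : ℕ, Integrable (fun p => ((Y.ker E n p * f (Y.T^[m * s] (Y.φ p)) : ℝ) : ℂ)) Y.μ :=
    fun s n => (Y.kg_int E n (m * s) hfi).ofReal
  have hexp : ∫ p, Y.av E (fun _ _ => 1) (fun y => (f y : ℂ)) (ℓ * N) p ∂Y.μ =
      (ℓ : ℂ)⁻¹ * ∑ s ∈ Finset.range ℓ, ∫ p, ((N : ℂ)⁻¹ * ∑ n ∈ Finset.range N,
        (Y.ker E ((ℓ + m) * n + s) p : ℂ)) * (f (Y.T^[m * s] (Y.φ p)) : ℂ) ∂Y.μ := by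
    have a1 : ∫ p, Y.av E (fun _ _ => 1) (fun y => (f y : ℂ)) (ℓ * N) p ∂Y.μ =
        ((ℓ * N : ℕ) : ℂ)⁻¹ * ∑ n ∈ Finset.range (ℓ * N),
          ∫ p, ((Y.ker E n p * f (Y.T^[m * n] (Y.φ p)) : ℝ) : ℂ) ∂Y.μ := by
      rw [← integral_finsetSum _ fun n _ => hInteg n n, ← integral_const_mul]
      refine integral_congr_ae (Eventually.of_forall fun p => ?_)
      simp [av]
    rw [a1, sum_range_mul_split, Nat.cast_mul, mul_inv, mul_assoc]
    congr 1
    rw [Finset.mul_sum]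
    refine Finset.sum_congr rfl fun s _ => ?_
    have a2 : ∀ n, ∫ p, ((Y.ker E (ℓ * n + s) p * f (Y.T^[m * (ℓ * n + s)] (Y.φ p)) : ℝ) : ℂ) ∂Y.μ =
        ∫ p, ((Y.ker E ((ℓ + m) * n + s) p * f (Y.T^[m * s] (Y.φ p)) : ℝ) : ℂ) ∂Y.μ := by
      intro n
      rw [integral_complex_ofReal, integral_complex_ofReal, Y.kg_shift E n s hfi]
    simp only [a2]
    rw [← integral_finsetSum _ fun n _ => hInteg s _, ← integral_const_mul]
    refine integral_congr_ae (Eventually.of_forall fun p => ?_)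
    simp only [Complex.ofReal_mul]
    rw [← Finset.sum_mul, mul_assoc]
  have hbet : ‖∫ p, Y.av E (fun _ _ => 1) (fun y => (f y : ℂ)) (ℓ * N) p ∂Y.μ - Y.beta R f‖ ≤ ε / 2 := by
    rw [hexp, beta, ← mul_sub, ← Finset.sum_sub_distrib, norm_mul, norm_inv, Complex.norm_natCast,
      inv_mul_le_iff₀ hℓr]
    refine (norm_sum_le _ _).trans ?_
    calc _ ≤ ∑ s ∈ Finset.range ℓ, ε / 2 := Finset.sum_le_sum fun s hs => ?_
      _ = ℓ * (ε / 2) := by simp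
    have i1 : Integrable (fun p => ((N : ℂ)⁻¹ * ∑ n ∈ Finset.range N,
        (Y.ker E ((ℓ + m) * n + s) p : ℂ)) * (f (Y.T^[m * s] (Y.φ p)) : ℂ)) Y.μ := by
      have := (integrable_finsetSum (Finset.range N) fun n _ => hInteg s ((ℓ + m) * n + s)).const_mul
        (N : ℂ)⁻¹
      refine this.congr (Eventually.of_forall fun p => ?_)
      simp only [Complex.ofReal_mul]
      rw [← Finset.sum_mul, mul_assoc]
    have i2 : Integrable (fun p => Y.rw' R s p * (f (Y.T^[m * s] (Y.φ p)) : ℂ)) Y.μ := by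
      refine Integrable.bdd_mul (c := R.card) (Y.P_int (m * s) hfi).ofReal
        (Y.rw_meas R s).aestronglyMeasurable (Eventually.of_forall fun p => Y.rw_norm R s p)
    rw [← integral_sub i1 i2]
    refine (norm_integral_le_of_norm_le_const (C := ε / 2) (Eventually.of_forall fun p => ?_)).trans
      (by simp)
    rw [← sub_mul, norm_mul]
    refine (mul_le_of_le_one_right (norm_nonneg _) (hfn _)).trans ?_
    have b1 := hN2 s hs (Y.z p)⁻¹
    have b2 : ‖∑ w ∈ R, (corr E w : ℂ) * ((w ^ s * (Y.z p)⁻¹ w : Circle) : ℂ) - Y.rw' R s p‖ ≤ ε / 4 := by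
      unfold rw'
      rw [← Finset.sum_sub_distrib]
      refine (norm_sum_le _ _).trans ?_
      calc _ ≤ ∑ w ∈ R, ε / (4 * (R.card + 1)) := Finset.sum_le_sum fun w hw => ?_
        _ = R.card * (ε / (4 * (R.card + 1))) := by simp
        _ ≤ (R.card + 1) * (ε / (4 * (R.card + 1))) := by gcongr; linarith
        _ = ε / 4 := by field_simp
      rw [MonoidHom.inv_apply, ← sub_one_mul, norm_mul, Circle.norm_coe, mul_one]
      have c1 := hEc w hw
      have c2 := corr_le hE w
      rw [← Complex.ofReal_one, ← Complex.ofReal_sub, Complex.norm_real, Real.norm_eq_abs, abs_le]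
      constructor <;> linarith [show 0 < ε / (4 * ((R.card : ℝ) + 1)) by positivity]
    calc _ = ‖((N : ℂ)⁻¹ * ∑ n ∈ Finset.range N, (Psi E (tw ((ℓ + m) * n + s) (Y.z p)⁻¹) : ℂ) -
        ∑ w ∈ R, (corr E w : ℂ) * ((w ^ s * (Y.z p)⁻¹ w : Circle) : ℂ)) +
        (∑ w ∈ R, (corr E w : ℂ) * ((w ^ s * (Y.z p)⁻¹ w : Circle) : ℂ) - Y.rw' R s p)‖ := by
          rw [sub_add_sub_cancel]; rfl
      _ ≤ ε / 4 + ε / 4 := (norm_add_le _ _).trans (add_le_add b1 b2)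
      _ = ε / 2 := by ring
  calc _ = ‖(∫ p, Y.av E (fun _ _ => 1) (fun y => (f y : ℂ)) (ℓ * N) p ∂Y.μ - Y.beta R f) -
      (∫ p, Y.av E (fun _ _ => 1) (fun y => (f y : ℂ)) (ℓ * N) p ∂Y.μ - τ)‖ := by congr 1; ring
    _ ≤ ε / 2 + ε / 4 := (norm_sub_le _ _).trans (add_le_add hbet hN1)
    _ = 3 * ε / 4 := by ring

end Sys
end SumsetAux

namespace SumsetAux
variable {ℓ m : ℕ} {Ω : Type} [MeasurableSpace Ω] (Y : Sys ℓ m Ω)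
namespace Sys

/-- density of S at p, smoothed -/
noncomputable def rho (E : Finset Circle) (S : Set Ω) (p : Ω) : ℝ :=
  ∫ y in S, Psi E (Y.z y * (Y.z p)⁻¹) ∂Y.μ

/-- fourier coefficient -/
noncomputable def fc (S : Set Ω) (χ : Circle) : ℂ := ∫ y in S, (Y.z y χ : ℂ) ∂Y.μ

lemma z_int (S : Set Ω) (χ : Circle) : IntegrableOn (fun y => (Y.z y χ : ℂ)) S Y.μ :=
  (Integrable.of_bound (Y.z_meas χ).aestronglyMeasurable 1
    (Eventually.of_forall fun y => (Circle.norm_coe _).le)).integrableOn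

lemma rho_eq (E : Finset Circle) (S : Set Ω) (p : Ω) :
    (Y.rho E S p : ℂ) = (E.card : ℂ)⁻¹ * ∑ x ∈ E ×ˢ E,
      (((Y.z p (x.1 / x.2))⁻¹ : Circle) : ℂ) * Y.fc S (x.1 / x.2) := by
  unfold rho fc
  rw [← integral_complex_ofReal]
  simp only [Psi_eq]
  rw [integral_const_mul, integral_finsetSum]
  · congr 1
    refine Finset.sum_congr rfl fun x _ => ?_
    rw [← integral_const_mul]
    refine integral_congr_ae (Eventually.of_forall fun y => ?_)
    simp only [MonoidHom.mul_apply, MonoidHom.inv_apply, Circle.coe_mul]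
    ring
  · intro x _
    simp only [MonoidHom.mul_apply, MonoidHom.inv_apply, Circle.coe_mul]
    exact (Y.z_int S _).mul_const _

lemma rho_meas (E : Finset Circle) (S : Set Ω) : Measurable (Y.rho E S) := by
  have h : Y.rho E S = fun p => ((E.card : ℂ)⁻¹ * ∑ x ∈ E ×ˢ E,
      (((Y.z p (x.1 / x.2))⁻¹ : Circle) : ℂ) * Y.fc S (x.1 / x.2)).re := by
    ext p; rw [← rho_eq, Complex.ofReal_re]
  rw [h]
  refine Complex.measurable_re.comp (Measurable.const_mul ?_ _)
  refine Finset.measurable_fun_sum _ fun x _ => ?_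
  exact (Y.zi_meas _).mul_const _

lemma psi_int_meas (E : Finset Circle) (p : Ω) : Measurable fun y => Psi E (Y.z y * (Y.z p)⁻¹) := by
  unfold Psi
  refine Measurable.const_mul (Measurable.pow_const (Measurable.norm ?_) 2) _
  refine Finset.measurable_fun_sum _ fun χ _ => ?_
  simp only [MonoidHom.mul_apply, MonoidHom.inv_apply, Circle.coe_mul]
  exact (Y.z_meas χ).mul_const _

lemma psi_int (E : Finset Circle) (p : Ω) : Integrable (fun y => Psi E (Y.z y * (Y.z p)⁻¹)) Y.μ := by
  refine Integrable.of_bound (Y.psi_int_meas E p).aestronglyMeasurable E.card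
    (Eventually.of_forall fun y => ?_)
  rw [Real.norm_of_nonneg (Psi_nonneg _ _)]
  exact Psi_le _ _

lemma rho_mono (E : Finset Circle) {S S' : Set Ω} (h : S ⊆ S') (p : Ω) :
    Y.rho E S p ≤ Y.rho E S' p := by
  unfold rho
  exact setIntegral_mono_set (Y.psi_int E p).integrableOn
    (Eventually.of_forall fun _ => Psi_nonneg _ _) (Eventually.of_forall h)

lemma rho_nonneg (E : Finset Circle) (S : Set Ω) (p : Ω) : 0 ≤ Y.rho E S p :=
  integral_nonneg fun _ => Psi_nonneg _ _

lemma rho_le (E : Finset Circle) (S : Set Ω) (p : Ω) : Y.rho E S p ≤ E.card := by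
  refine (Y.rho_mono E (Set.subset_univ S) p).trans ?_
  unfold rho
  rw [setIntegral_univ]
  refine (integral_mono (Y.psi_int E p) (integrable_const (E.card : ℝ)) fun y => Psi_le _ _).trans ?_
  simp

lemma rho_int (E : Finset Circle) (S : Set Ω) : Integrable (Y.rho E S) Y.μ :=
  Integrable.of_bound (Y.rho_meas E S).aestronglyMeasurable E.card
    (Eventually.of_forall fun y => by
      rw [Real.norm_of_nonneg (Y.rho_nonneg _ _ _)]; exact Y.rho_le _ _ _)

lemma fc_one (S : Set Ω) : Y.fc S 1 = (Y.μ.real S : ℂ) := by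
  unfold fc; simp [Measure.real]

lemma fc_inv (S : Set Ω) (χ : Circle) :
    ∫ y in S, (((Y.z y χ)⁻¹ : Circle) : ℂ) ∂Y.μ = (starRingEnd ℂ) (Y.fc S χ) := by
  unfold fc
  rw [← integral_conj]
  simp only [Circle.coe_inv_eq_conj]

lemma rho_self {E : Finset Circle} (hE : E.Nonempty) (S : Set Ω) :
    (Y.μ.real S) ^ 2 ≤ ∫ p in S, Y.rho E S p ∂Y.μ := by
  have h0 : (0 : ℝ) < E.card := by exact_mod_cast hE.card_pos
  have h : ∫ p in S, Y.rho E S p ∂Y.μ = (E.card : ℝ)⁻¹ * ∑ x ∈ E ×ˢ E, ‖Y.fc S (x.1 / x.2)‖ ^ 2 := by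
    apply Complex.ofReal_injective
    rw [← integral_complex_ofReal]
    simp only [rho_eq]
    rw [integral_const_mul, integral_finsetSum]
    · rw [Complex.ofReal_mul, Complex.ofReal_inv, Complex.ofReal_natCast, Complex.ofReal_sum]
      congr 1
      refine Finset.sum_congr rfl fun x _ => ?_
      rw [integral_mul_const, fc_inv, ← Complex.normSq_eq_conj_mul_self, Complex.normSq_eq_norm_sq]
    · intro x _
      refine Integrable.mul_const ?_ _
      exact (Integrable.of_bound (Y.zi_meas _).aestronglyMeasurable 1
        (Eventually.of_forall fun y => (Circle.norm_coe _).le)).integrableOn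
  rw [h, le_inv_mul_iff₀ h0]
  have h1 : ∑ x ∈ E.diag, ‖Y.fc S (x.1 / x.2)‖ ^ 2 = E.card * Y.μ.real S ^ 2 := by
    rw [Finset.sum_congr rfl (g := fun _ => Y.μ.real S ^ 2), Finset.sum_const, Finset.diag_card]
    · simp
    · intro x hx
      rw [Finset.mem_diag] at hx
      rw [hx.2, div_self', fc_one, Complex.norm_real, Real.norm_of_nonneg measureReal_nonneg]
  rw [← h1]
  refine Finset.sum_le_sum_of_subset_of_nonneg ?_ fun _ _ _ => by positivity
  intro x hx
  rw [Finset.mem_diag] at hx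
  rw [Finset.mem_product]
  exact ⟨hx.1, hx.2 ▸ hx.1⟩

lemma rho_small {E : Finset Circle} (hE : E.Nonempty) {S S' : Set Ω} (hS : MeasurableSet S)
    (hSS : S ⊆ S') (δ : ℝ) (h : ∀ p ∈ S, Y.rho E S' p < δ) : Y.μ.real S ≤ δ ∨ Y.μ.real S = 0 := by
  have h1 := Y.rho_self hE S
  have h2 : ∫ p in S, Y.rho E S p ∂Y.μ ≤ ∫ p in S, δ ∂Y.μ :=
    setIntegral_mono_on (Y.rho_int E S).integrableOn (integrable_const _) hS
      fun p hp => (Y.rho_mono E hSS p).trans (h p hp).le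
  rw [setIntegral_const, smul_eq_mul] at h2
  rcases eq_or_ne (Y.μ.real S) 0 with h3 | h3
  · exact Or.inr h3
  · left
    have h4 : 0 < Y.μ.real S := lt_of_le_of_ne measureReal_nonneg h3.symm
    by_contra hc
    push Not at hc
    nlinarith

lemma rho_unif (E : Finset Circle) (S : Set Ω) (c : ℕ → ℝ) (u : Filter ℕ)
    (h : ∀ χ : Circle, Tendsto (fun M : ℕ => (M : ℂ)⁻¹ * ∑ n ∈ Finset.range M, (c n : ℂ) * (χ : ℂ) ^ n)
      u (𝓝 (Y.fc S χ))) (ε : ℝ) (hε : 0 < ε) :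
    ∀ᶠ M : ℕ in u, ∀ p, |(M : ℝ)⁻¹ * ∑ n ∈ Finset.range M, c n * Y.ker E n p - Y.rho E S p| ≤ ε := by
  have h1 : ∀ᶠ M : ℕ in u, ∀ x ∈ E ×ˢ E, ‖(M : ℂ)⁻¹ * ∑ n ∈ Finset.range M, (c n : ℂ) *
      ((x.1 / x.2 : Circle) : ℂ) ^ n - Y.fc S (x.1 / x.2)‖ < ε / (E.card + 1) := by
    rw [Filter.eventually_all_finset]
    intro x _
    have := (tendsto_iff_norm_sub_tendsto_zero.1 (h (x.1 / x.2)))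
    exact this.eventually_lt_const (by positivity)
  filter_upwards [h1] with M hM p
  have h2 : (((M : ℝ)⁻¹ * ∑ n ∈ Finset.range M, c n * Y.ker E n p - Y.rho E S p : ℝ) : ℂ) =
      (E.card : ℂ)⁻¹ * ∑ x ∈ E ×ˢ E, (((Y.z p (x.1 / x.2))⁻¹ : Circle) : ℂ) *
        ((M : ℂ)⁻¹ * ∑ n ∈ Finset.range M, (c n : ℂ) *
          ((x.1 / x.2 : Circle) : ℂ) ^ n - Y.fc S (x.1 / x.2)) := by
    simp only [Complex.ofReal_sub, Complex.ofReal_mul, Complex.ofReal_inv, Complex.ofReal_natCast,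
      Complex.ofReal_sum]
    simp only [mul_sub, Finset.sum_sub_distrib]
    rw [rho_eq]
    congr 1
    unfold ker
    simp only [Psi_eq, tw_apply, MonoidHom.inv_apply, Finset.mul_sum]
    rw [Finset.sum_comm]
    refine Finset.sum_congr rfl fun x _ => Finset.sum_congr rfl fun n _ => ?_
    rw [Circle.coe_mul, Circle.coe_pow]
    ring
  rw [← Real.norm_eq_abs, ← Complex.norm_real, h2, norm_mul, norm_inv, Complex.norm_natCast]
  have h3 : ‖∑ x ∈ E ×ˢ E, (((Y.z p (x.1 / x.2))⁻¹ : Circle) : ℂ) *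
        ((M : ℂ)⁻¹ * ∑ n ∈ Finset.range M, (c n : ℂ) *
          ((x.1 / x.2 : Circle) : ℂ) ^ n - Y.fc S (x.1 / x.2))‖ ≤
        ∑ x ∈ E ×ˢ E, ε / (E.card + 1) := by
    refine (norm_sum_le _ _).trans (Finset.sum_le_sum fun x hx => ?_)
    rw [norm_mul, Circle.norm_coe, one_mul]
    exact (hM x hx).le
  rw [Finset.sum_const, Finset.card_product, nsmul_eq_mul] at h3
  rcases Finset.eq_empty_or_nonempty E with rfl | hE
  · simpa using hε.le
  have h0 : (0 : ℝ) < E.card := by exact_mod_cast hE.card_pos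
  rw [inv_mul_le_iff₀ h0]
  refine h3.trans ?_
  push_cast
  rw [mul_assoc]
  gcongr
  rw [mul_div_assoc', div_le_iff₀ (by positivity)]
  nlinarith

end Sys
end SumsetAux

namespace SumsetAux
variable {ℓ m : ℕ} {Ω : Type} [MeasurableSpace Ω] (Y : Sys ℓ m Ω)
namespace Sys

lemma core2 (hℓ : 0 < ℓ) (hm : 0 < m) (R : Finset Circle) (hR : ∀ w, w ∈ R ↔ w ^ (ℓ + m) = 1)
    (f : Ω → ℝ) (hf : Measurable f) (hf0 : ∀ y, 0 ≤ f y) (hf1 : ∀ y, f y ≤ 1)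
    (r : ℕ) (X Gh : Fin r → Set Ω) (hX : ∀ j, MeasurableSet (X j)) (hXG : ∀ j, X j ⊆ Gh j)
    (hdis : ∀ i j, i ≠ j → Disjoint (X i) (X j))
    (c : Fin r → ℕ → ℝ) (hc : ∀ j n, 0 ≤ c j n ∧ c j n ≤ 1) (u : Filter ℕ) [u.NeBot] (hu : u ≤ atTop)
    (hlim : ∀ j, ∀ χ : Circle, Tendsto (fun M : ℕ => (M : ℂ)⁻¹ *
      ∑ n ∈ Finset.range M, (c j n : ℂ) * (χ : ℂ) ^ n) u (𝓝 (Y.fc (Gh j) χ)))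
    (hfin : ∀ j, ∀ p ∈ X j, {n : ℕ | c j n * f (Y.T^[m * n] (Y.φ p)) ≠ 0}.Finite) :
    Y.μ.real (⋃ j, X j) ≤ 1 - (Y.beta R f).re := by
  classical
  refine le_of_forall_pos_le_add fun η₀ hη₀ => ?_
  set η := η₀ / 4 with hη
  have hη0 : 0 < η := by positivity
  set δ : ℝ := min 1 (η / (r + 1)) with hδ
  have hδ0 : 0 < δ := lt_min one_pos (by positivity)
  have hδ1 : δ ≤ 1 := min_le_left _ _
  have hC : 1 ≤ δ⁻¹ := (one_le_inv₀ hδ0).2 hδ1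
  obtain ⟨E, hE, hmain⟩ := Y.core1 hℓ hm R hR f hf hf0 hf1 δ⁻¹ η hC hη0
  have hEr : (0 : ℝ) < E.card := by exact_mod_cast hE.card_pos
  let S : Fin r → Set Ω := fun j => X j ∩ {p | Y.rho E (Gh j) p < δ}
  let X' : Fin r → Set Ω := fun j => X j ∩ {p | δ ≤ Y.rho E (Gh j) p}
  have hSm : ∀ j, MeasurableSet (S j) := fun j =>
    (hX j).inter (measurableSet_lt (Y.rho_meas E _) measurable_const)
  have hX'm : ∀ j, MeasurableSet (X' j) := fun j =>
    (hX j).inter (measurableSet_le measurable_const (Y.rho_meas E _))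
  have hS : ∀ j, Y.μ.real (S j) ≤ δ := by
    intro j
    rcases Y.rho_small hE (hSm j) (Set.inter_subset_left.trans (hXG j)) δ (fun p hp => hp.2) with h | h
    · exact h
    · rw [h]; exact hδ0.le
  set U : Set Ω := ⋃ j, X' j with hU
  have hUm : MeasurableSet U := MeasurableSet.iUnion hX'm
  have hXU : Y.μ.real (⋃ j, X j) ≤ Y.μ.real U + r * δ := by
    have h1 : (⋃ j, X j) ⊆ U ∪ ⋃ j, S j := by
      intro p hp
      obtain ⟨j, hj⟩ := Set.mem_iUnion.1 hp
      by_cases h : δ ≤ Y.rho E (Gh j) p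
      · exact Or.inl (Set.mem_iUnion.2 ⟨j, hj, h⟩)
      · exact Or.inr (Set.mem_iUnion.2 ⟨j, hj, not_le.1 h⟩)
    refine (measureReal_mono h1).trans ((measureReal_union_le _ _).trans ?_)
    gcongr
    refine (measureReal_iUnion_fintype_le _).trans ?_
    refine (Finset.sum_le_sum fun j _ => hS j).trans ?_
    simp
  let W : ℕ → Ω → ℝ := fun n p => (Uᶜ).indicator (fun _ => (1 : ℝ)) p +
    ∑ j, (X' j).indicator (fun p => (Y.rho E (Gh j) p)⁻¹) p * c j n
  have hW1 : ∀ n p, p ∉ U → W n p = 1 := by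
    intro n p hp
    simp only [W]
    rw [Set.indicator_of_mem (show p ∈ Uᶜ from hp), Finset.sum_eq_zero, add_zero]
    intro j _
    rw [Set.indicator_of_notMem, zero_mul]
    exact fun h => hp (Set.mem_iUnion.2 ⟨j, h⟩)
  have hW2 : ∀ n p j, p ∈ X' j → W n p = (Y.rho E (Gh j) p)⁻¹ * c j n := by
    intro n p j hp
    simp only [W]
    rw [Set.indicator_of_notMem (show p ∉ Uᶜ from fun h => h (Set.mem_iUnion.2 ⟨j, hp⟩)),
      Finset.sum_eq_single j, Set.indicator_of_mem hp, zero_add]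
    · intro i _ hij
      rw [Set.indicator_of_notMem, zero_mul]
      exact fun h => Set.disjoint_left.1 (hdis i j hij) h.1 hp.1
    · simp
  have hinv : ∀ p j, p ∈ X' j → 0 < (Y.rho E (Gh j) p)⁻¹ ∧ (Y.rho E (Gh j) p)⁻¹ ≤ δ⁻¹ := by
    intro p j hp
    have : δ ≤ Y.rho E (Gh j) p := hp.2
    exact ⟨inv_pos.2 (hδ0.trans_le this), inv_anti₀ hδ0 this⟩
  have hWb : ∀ n p, 0 ≤ W n p ∧ W n p ≤ δ⁻¹ := by
    intro n p
    by_cases hp : p ∈ U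
    · obtain ⟨j, hj⟩ := Set.mem_iUnion.1 hp
      rw [hW2 n p j hj]
      obtain ⟨h1, h2⟩ := hinv p j hj
      exact ⟨mul_nonneg h1.le (hc j n).1, (mul_le_of_le_one_right h1.le (hc j n).2).trans h2⟩
    · rw [hW1 n p hp]; exact ⟨zero_le_one, hC⟩
  have hWt : Wt δ⁻¹ W := by
    refine ⟨hWb, r + 1, Fin.cons ((Uᶜ).indicator (fun _ => (1 : ℝ)))
      (fun j => (X' j).indicator (fun p => (Y.rho E (Gh j) p)⁻¹)), Fin.cons (fun _ => 1) c, ?_, ?_, ?_, ?_⟩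
    · intro i
      refine Fin.cases ?_ (fun j => ?_) i
      · exact measurable_const.indicator hUm.compl
      · exact (Y.rho_meas E _).inv.indicator (hX'm j)
    · intro i p
      refine Fin.cases ?_ (fun j => ?_) i
      · simp only [Fin.cons_zero, Set.indicator]
        split_ifs
        · simpa using hC
        · simpa using hδ0.le
      · simp only [Fin.cons_succ]
        by_cases hp : p ∈ X' j
        · rw [Set.indicator_of_mem hp, abs_of_pos (hinv p j hp).1]; exact (hinv p j hp).2
        · rw [Set.indicator_of_notMem hp]; simpa using hδ0.le
    · intro i n
      refine Fin.cases ?_ (fun j => ?_) i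
      · simp
      · simp only [Fin.cons_succ]; rw [abs_of_nonneg (hc j n).1]; exact (hc j n).2
    · intro n p
      rw [Fin.sum_univ_succ]
      simp [W]
  have happ : ∀ ε' > 0, ∀ᶠ M : ℕ in u, ∀ p,
        |(M : ℝ)⁻¹ * ∑ n ∈ Finset.range M, W n p * Y.ker E n p - 1| ≤ ε' := by
    intro ε' hε'
    have h1 := hu (psi_unif_one hE ε' hε')
    have h2 : ∀ᶠ M : ℕ in u, ∀ j ∈ (Finset.univ : Finset (Fin r)), ∀ p,
        |(M : ℝ)⁻¹ * ∑ n ∈ Finset.range M, c j n * Y.ker E n p - Y.rho E (Gh j) p| ≤ ε' * δ := by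
      rw [Filter.eventually_all_finset]
      intro j _
      exact Y.rho_unif E (Gh j) (c j) u (hlim j) _ (by positivity)
    filter_upwards [h1, h2] with M h1 h2 p
    by_cases hp : p ∈ U
    · obtain ⟨j, hj⟩ := Set.mem_iUnion.1 hp
      have h3 := h2 j (Finset.mem_univ _) p
      obtain ⟨h4, h5⟩ := hinv p j hj
      have h6 : (M : ℝ)⁻¹ * ∑ n ∈ Finset.range M, W n p * Y.ker E n p - 1 =
          (Y.rho E (Gh j) p)⁻¹ * ((M : ℝ)⁻¹ * ∑ n ∈ Finset.range M, c j n * Y.ker E n p -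
            Y.rho E (Gh j) p) := by
        have h7 : ∑ n ∈ Finset.range M, W n p * Y.ker E n p =
            (Y.rho E (Gh j) p)⁻¹ * ∑ n ∈ Finset.range M, c j n * Y.ker E n p := by
          rw [Finset.mul_sum]
          refine Finset.sum_congr rfl fun n _ => ?_
          rw [hW2 n p j hj, mul_assoc]
        rw [mul_sub, inv_mul_cancel₀ (inv_pos.1 h4).ne', h7, mul_left_comm]
      rw [h6, abs_mul, abs_of_pos h4]
      calc _ ≤ δ⁻¹ * (ε' * δ) := by gcongr
        _ = ε' := by field_simp
    · have := h1 (Y.z p)⁻¹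
      simpa [hW1 _ p hp, ker] using this
  have hb := hmain u hu W hWt happ
  -- the real integrand
  let F : ℕ → Ω → ℝ := fun M p => (M : ℝ)⁻¹ * ∑ n ∈ Finset.range M,
    W n p * Y.ker E n p * f (Y.T^[m * n] (Y.φ p))
  have hFav : ∀ M p, Y.av E W (fun y => (f y : ℂ)) M p = (F M p : ℂ) := by
    intro M p
    simp only [av, F]
    push_cast
    rfl
  have hFm : ∀ M, Measurable (F M) := by
    intro M
    refine Measurable.const_mul (Finset.measurable_fun_sum _ fun n _ => ?_) _
    exact ((hWt.meas n).mul (Y.ker_meas E n)).mul (hf.comp (Y.P_meas _))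
  have hWk : ∀ n p, 0 ≤ W n p * Y.ker E n p := fun n p =>
    mul_nonneg (hWb n p).1 (Y.ker_nonneg _ _ _)
  have hF0 : ∀ M p, 0 ≤ F M p := by
    intro M p
    refine mul_nonneg (by positivity) (Finset.sum_nonneg fun n _ => mul_nonneg (hWk n p) (hf0 _))
  have hFle : ∀ M p, F M p ≤ (M : ℝ)⁻¹ * ∑ n ∈ Finset.range M, W n p * Y.ker E n p := by
    intro M p
    simp only [F]
    refine mul_le_mul_of_nonneg_left (Finset.sum_le_sum fun n _ => ?_) (by positivity)
    exact mul_le_of_le_one_right (hWk n p) (hf1 _)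
  have hFle2 : ∀ M p, F M p ≤ δ⁻¹ * E.card := by
    intro M p
    refine (hFle M p).trans ?_
    have : ∑ n ∈ Finset.range M, W n p * Y.ker E n p ≤ ∑ n ∈ Finset.range M, δ⁻¹ * E.card :=
      Finset.sum_le_sum fun n _ => mul_le_mul (hWb n p).2 (Y.ker_le _ _ _) (Y.ker_nonneg _ _ _)
        (by positivity)
    rw [Finset.sum_const, Finset.card_range, nsmul_eq_mul] at this
    rcases Nat.eq_zero_or_pos M with rfl | hM
    · simp; positivity
    · have hMr : (0 : ℝ) < M := by exact_mod_cast hM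
      rwa [inv_mul_le_iff₀ hMr]
  have hFi : ∀ M, Integrable (F M) Y.μ := fun M =>
    Integrable.of_bound (hFm M).aestronglyMeasurable (δ⁻¹ * E.card) (Eventually.of_forall fun p => by
      rw [Real.norm_of_nonneg (hF0 _ _)]; exact hFle2 _ _)
  have hFt : ∀ p ∈ U, Tendsto (fun M => F M p) atTop (𝓝 0) := by
    intro p hp
    obtain ⟨j, hj⟩ := Set.mem_iUnion.1 hp
    have hfi := hfin j p hj.1
    obtain ⟨K, hK⟩ := hfi.bddAbove
    have hz : ∀ n, K < n → W n p * Y.ker E n p * f (Y.T^[m * n] (Y.φ p)) = 0 := by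
      intro n hn
      have h1 : c j n * f (Y.T^[m * n] (Y.φ p)) = 0 := by
        by_contra h
        exact absurd (hK h) (not_le.2 hn)
      rw [hW2 n p j hj]
      linear_combination (Y.rho E (Gh j) p)⁻¹ * Y.ker E n p * h1
    have h2 : Tendsto (fun M : ℕ => (M : ℝ)⁻¹ * ∑ n ∈ Finset.range (K + 1),
        W n p * Y.ker E n p * f (Y.T^[m * n] (Y.φ p))) atTop (𝓝 0) := by
      have := (tendsto_inv_atTop_nhds_zero_nat (𝕜 := ℝ)).mul_const (∑ n ∈ Finset.range (K + 1),
        W n p * Y.ker E n p * f (Y.T^[m * n] (Y.φ p)))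
      simpa using this
    refine h2.congr' ?_
    filter_upwards [eventually_ge_atTop (K + 1)] with M hM
    simp only [F]
    congr 1
    refine Finset.sum_subset (Finset.range_subset_range.2 hM) fun n _ hn => hz n ?_
    simpa using hn
  have hI1 : Tendsto (fun M => ∫ p in U, F M p ∂Y.μ) atTop (𝓝 0) := by
    have := tendsto_integral_of_dominated_convergence (μ := Y.μ.restrict U) (F := F) (f := fun _ => 0)
      (fun _ => δ⁻¹ * E.card) (fun M => (hFm M).aestronglyMeasurable) (integrable_const _)
      (fun M => Eventually.of_forall fun p => by
        rw [Real.norm_of_nonneg (hF0 _ _)]; exact hFle2 _ _)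
      ((ae_restrict_iff' hUm).2 (Eventually.of_forall hFt))
    simpa using this
  have hI1' := (hI1.mono_left hu).eventually_lt_const hη0
  obtain ⟨M, hM1, hM2, hM3⟩ := (hb.and (hI1'.and (happ η hη0))).exists
  simp only [hFav] at hM1
  rw [integral_complex_ofReal] at hM1
  have hre := (Complex.abs_re_le_norm _).trans hM1
  rw [Complex.sub_re, Complex.ofReal_re, abs_le] at hre
  rw [← integral_add_compl hUm (hFi M)] at hre
  have hI2 : ∫ p in Uᶜ, F M p ∂Y.μ ≤ (1 + η) * Y.μ.real Uᶜ := by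
    have := setIntegral_mono_on (s := Uᶜ) (hFi M).integrableOn 
      (integrable_const (1 + η)).integrableOn hUm.compl (fun p _ => (hFle M p).trans (by
        have := (abs_le.1 (hM3 p)).2
        linarith))
    refine this.trans ?_
    rw [setIntegral_const, smul_eq_mul, mul_comm]
  have hcompl : Y.μ.real Uᶜ = 1 - Y.μ.real U := probReal_compl_eq_one_sub hUm
  have hUle : Y.μ.real Uᶜ ≤ 1 := measureReal_le_one
  have hrδ : r * δ ≤ η := by
    have h1 : δ ≤ η / (r + 1) := min_le_right _ _
    calc (r : ℝ) * δ ≤ (r + 1) * (η / (r + 1)) := by gcongr; linarith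
      _ = η := by field_simp
  have : (1 + η) * Y.μ.real Uᶜ ≤ Y.μ.real Uᶜ + η := by nlinarith
  linarith

end Sys
end SumsetAux

namespace SumsetAux

/-- Borel structure on the space of ultrafilters -/
noncomputable instance instMeasBN : MeasurableSpace (Ultrafilter ℕ) := borel _
instance instBorelBN : BorelSpace (Ultrafilter ℕ) := ⟨rfl⟩

/-- empirical measure -/
noncomputable def emp (M : ℕ) : Measure (Ultrafilter ℕ) :=
  ((M + 1 : ℕ) : ENNReal)⁻¹ • ∑ n ∈ Finset.range (M + 1), Measure.dirac (pure n)

instance emp_prob (M : ℕ) : IsProbabilityMeasure (emp M) := by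
  constructor
  unfold emp
  simp only [Measure.smul_apply, Measure.finsetSum_apply, measure_univ, Finset.sum_const,
    Finset.card_range, smul_eq_mul, nsmul_eq_mul, mul_one]
  exact ENNReal.inv_mul_cancel (by simp) (by simp)

lemma emp_int (M : ℕ) (g : C(Ultrafilter ℕ, ℝ)) :
    ∫ p, g p ∂(emp M) = ((M + 1 : ℕ) : ℝ)⁻¹ * ∑ n ∈ Finset.range (M + 1), g (pure n) := by
  unfold emp
  rw [integral_smul_measure, integral_finsetSum_measure]
  · rw [ENNReal.toReal_inv, ENNReal.toReal_natCast, smul_eq_mul]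
    simp
  · intro n _
    refine Integrable.of_bound g.continuous.measurable.aestronglyMeasurable ‖g‖ 
      (Eventually.of_forall fun p => g.norm_coe_le_norm p)

lemma bcf_cont {F : Type*} [NormedAddCommGroup F] {g : Ultrafilter ℕ → F} (hg : Continuous g) :
    ∃ C, ∀ p, ‖g p‖ ≤ C := by
  obtain ⟨C, hC⟩ := (isCompact_range hg).isBounded.exists_norm_le
  exact ⟨C, fun p => hC _ ⟨p, rfl⟩⟩

lemma exists_mean (u : Ultrafilter ℕ) (hu : (u : Filter ℕ) ≤ atTop) :
    ∃ μ : Measure (Ultrafilter ℕ), μ.Regular ∧ IsProbabilityMeasure μ ∧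
      ∀ g : C(Ultrafilter ℕ, ℝ), Tendsto (fun M : ℕ => (M : ℝ)⁻¹ * ∑ n ∈ Finset.range M, g (pure n))
        u (𝓝 (∫ p, g p ∂μ)) := by
  let e : ℕ → ProbabilityMeasure (Ultrafilter ℕ) := fun M => ⟨emp (M - 1), inferInstance⟩
  obtain ⟨P, -, hP⟩ := isCompact_univ.ultrafilter_le_nhds (u.map e) (by simp)
  have hP' : Tendsto e u (𝓝 P) := hP
  rw [ProbabilityMeasure.tendsto_iff_forall_integral_tendsto] at hP'
  obtain ⟨ν, hν, hνf, hνe⟩ := Measure.exists_regular_eq_of_compactSpace (P : Measure (Ultrafilter ℕ))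
  have h1 := hνe (BoundedContinuousFunction.const _ 1)
  have hνp : IsProbabilityMeasure ν := by
    constructor
    simp only [BoundedContinuousFunction.const_apply, integral_const, smul_eq_mul, mul_one,
      probReal_univ] at h1
    rw [← ENNReal.toReal_eq_one_iff]
    exact h1.symm
  refine ⟨ν, hν, hνp, fun g => ?_⟩
  have h2 := hP' (BoundedContinuousFunction.mkOfCompact g)
  rw [hνe] at h2
  refine Tendsto.congr' ?_ h2
  filter_upwards [hu (eventually_gt_atTop 0)] with M hM
  have h3 : M - 1 + 1 = M := Nat.sub_add_cancel hM
  have h4 := emp_int (M - 1) g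
  rw [h3] at h4
  exact h4

lemma meas_ext {μ ν : Measure (Ultrafilter ℕ)} [μ.Regular] [ν.Regular]
    (h : ∀ g : C(Ultrafilter ℕ, ℝ), ∫ p, g p ∂μ = ∫ p, g p ∂ν) : μ = ν :=
  Measure.ext_of_integral_eq_on_compactlySupported fun f => h f.toContinuousMap

lemma reg_map {μ : Measure (Ultrafilter ℕ)} [μ.Regular] [IsProbabilityMeasure μ] 
    {F : Ultrafilter ℕ → Ultrafilter ℕ} (hF : Continuous F) : (μ.map F).Regular := by
  have h1 : (μ.map F).InnerRegular := Measure.InnerRegular.map_of_continuous hF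
  have h2 : IsProbabilityMeasure (μ.map F) := Measure.isProbabilityMeasure_map hF.aemeasurable
  infer_instance

lemma umap_cont (k : ℕ → ℕ) : Continuous (Ultrafilter.map k : Ultrafilter ℕ → Ultrafilter ℕ) := by
  rw [ultrafilterBasis_is_basis.continuous_iff]
  rintro _ ⟨s, rfl⟩
  exact ultrafilter_isOpen_basic (k ⁻¹' s)

/-- shift -/
def sh : Ultrafilter ℕ → Ultrafilter ℕ := Ultrafilter.map (· + 1)

lemma sh_inv (u : Ultrafilter ℕ) (hu : (u : Filter ℕ) ≤ atTop) (μ : Measure (Ultrafilter ℕ))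
    [μ.Regular] [IsProbabilityMeasure μ]
    (h : ∀ g : C(Ultrafilter ℕ, ℝ), Tendsto (fun M : ℕ => (M : ℝ)⁻¹ * ∑ n ∈ Finset.range M, g (pure n))
        u (𝓝 (∫ p, g p ∂μ))) : MeasurePreserving sh μ μ := by
  have hc : Continuous sh := umap_cont _
  refine ⟨hc.measurable, ?_⟩
  have := reg_map (μ := μ) hc
  refine meas_ext fun g => ?_
  rw [integral_map hc.aemeasurable g.continuous.measurable.aestronglyMeasurable]
  have h1 := h (g.comp ⟨sh, hc⟩)
  have h2 := h g
  refine tendsto_nhds_unique h1 ?_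
  have h3 : Tendsto (fun M : ℕ => (M : ℝ)⁻¹ * (g (pure M) - g (pure 0))) u (𝓝 0) := by
    refine Tendsto.mono_left ?_ hu
    refine (tendsto_inv_atTop_nhds_zero_nat (𝕜 := ℝ)).zero_mul_isBoundedUnder_le ?_
    refine isBoundedUnder_of ⟨‖g‖ + ‖g‖, fun M => ?_⟩
    exact (norm_sub_le _ _).trans (add_le_add (g.norm_coe_le_norm _) (g.norm_coe_le_norm _))
  have h4 := h2.add h3
  rw [add_zero] at h4
  refine h4.congr fun M => ?_
  rw [← Finset.sum_range_sub (fun n => g (pure n)), ← mul_add, ← Finset.sum_add_distrib]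
  congr 1
  refine Finset.sum_congr rfl fun n _ => ?_
  rw [add_sub_cancel]
  rfl

lemma mean_complex (u : Ultrafilter ℕ) (μ : Measure (Ultrafilter ℕ)) [IsProbabilityMeasure μ]
    (h : ∀ g : C(Ultrafilter ℕ, ℝ), Tendsto (fun M : ℕ => (M : ℝ)⁻¹ * ∑ n ∈ Finset.range M, g (pure n))
        u (𝓝 (∫ p, g p ∂μ))) (g : Ultrafilter ℕ → ℂ) (hg : Continuous g) :
    Tendsto (fun M : ℕ => (M : ℂ)⁻¹ * ∑ n ∈ Finset.range M, g (pure n)) u (𝓝 (∫ p, g p ∂μ)) := by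
  obtain ⟨C, hC⟩ := bcf_cont hg
  have hi : Integrable g μ := Integrable.of_bound hg.measurable.aestronglyMeasurable C
    (Eventually.of_forall hC)
  have h1 := h ⟨fun p => (g p).re, Complex.continuous_re.comp hg⟩
  have h2 := h ⟨fun p => (g p).im, Complex.continuous_im.comp hg⟩
  have h3 := (((Complex.continuous_ofReal.tendsto _).comp h1).add
    (((Complex.continuous_ofReal.tendsto _).comp h2).mul_const Complex.I))
  simp only [ContinuousMap.coe_mk] at h3
  have h4 : ((∫ x, (g x).re ∂μ : ℝ) : ℂ) + (∫ x, (g x).im ∂μ : ℝ) * Complex.I = ∫ x, g x ∂μ :=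
    integral_re_add_im hi
  rw [h4] at h3
  refine h3.congr fun M => ?_
  simp only [Function.comp]
  push_cast
  rw [mul_assoc, ← mul_add, Finset.sum_mul, ← Finset.sum_add_distrib]
  simp only [Complex.re_add_im]

end SumsetAux

namespace SumsetAux

lemma ext_tendsto {γ : Type} [TopologicalSpace γ] [T2Space γ] [CompactSpace γ] (f : ℕ → γ)
    (p : Ultrafilter ℕ) : Tendsto f p (𝓝 (Ultrafilter.extend f p)) :=
  ultrafilter_extend_eq_iff.1 rfl

lemma ext_unique {γ : Type} [TopologicalSpace γ] [T2Space γ] [CompactSpace γ] {f : ℕ → γ}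
    {p : Ultrafilter ℕ} {c : γ} (h : Tendsto f p (𝓝 c)) : Ultrafilter.extend f p = c :=
  ultrafilter_extend_eq_iff.2 h

/-- generic character value -/
noncomputable def zU (p : Ultrafilter ℕ) : Circle →* Circle where
  toFun χ := Ultrafilter.extend (fun n => χ ^ n) p
  map_one' := ext_unique (by simp)
  map_mul' χ χ' := ext_unique (by
    simp only [mul_pow]
    exact (ext_tendsto (fun n => χ ^ n) p).mul (ext_tendsto (fun n => χ' ^ n) p))

lemma zU_cont (χ : Circle) : Continuous fun p => zU p χ := continuous_ultrafilter_extend _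

lemma zU_pure (n : ℕ) (χ : Circle) : zU (pure n) χ = χ ^ n := ultrafilter_extend_pure _ _

lemma zU_sh (p : Ultrafilter ℕ) (χ : Circle) : zU (sh p) χ = χ * zU p χ := by
  refine ext_unique ?_
  have h : Tendsto (fun n => χ * χ ^ n) p (𝓝 (χ * zU p χ)) := 
    (ext_tendsto (fun n => χ ^ n) p).const_mul χ
  have h2 : ((sh p : Ultrafilter ℕ) : Filter ℕ) = Filter.map (· + 1) (p : Filter ℕ) := rfl
  rw [h2, tendsto_map'_iff]
  refine h.congr fun n => ?_
  simp [pow_succ']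

lemma sh_cont : Continuous sh := umap_cont _

lemma sh_iter (k : ℕ) (p : Ultrafilter ℕ) : sh^[k] p = p.map (· + k) := by
  induction k with
  | zero => simp
  | succ k ih =>
    rw [Function.iterate_succ_apply', ih, sh, Ultrafilter.map_map]
    rfl

/-- dilation -/
def dil (ℓ : ℕ) : Ultrafilter ℕ → Ultrafilter ℕ := Ultrafilter.map (ℓ * ·)

lemma dil_cont (ℓ : ℕ) : Continuous (dil ℓ) := umap_cont _

lemma dil_sh (ℓ : ℕ) (p : Ultrafilter ℕ) : dil ℓ (sh p) = sh^[ℓ] (dil ℓ p) := by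
  rw [sh_iter, dil, sh, Ultrafilter.map_map, Ultrafilter.map_map]
  rfl

/-- averaged measure -/
noncomputable def nuU (ℓ : ℕ) (μ : Measure (Ultrafilter ℕ)) : Measure (Ultrafilter ℕ) :=
  (ℓ : ENNReal)⁻¹ • ∑ i ∈ Finset.range ℓ, μ.map (fun p => sh^[i] (dil ℓ p))

lemma shdil_meas (ℓ i : ℕ) : Measurable fun p => sh^[i] (dil ℓ p) :=
  ((sh_cont.iterate i).comp (dil_cont ℓ)).measurable

lemma nuU_prob {ℓ : ℕ} (hℓ : 0 < ℓ) (μ : Measure (Ultrafilter ℕ)) [IsProbabilityMeasure μ] :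
    IsProbabilityMeasure (nuU ℓ μ) := by
  constructor
  unfold nuU
  have h : ∀ i, μ.map (fun p => sh^[i] (dil ℓ p)) Set.univ = 1 := fun i => by
    rw [Measure.map_apply (shdil_meas ℓ i) MeasurableSet.univ]; simp
  simp only [Measure.smul_apply, Measure.finsetSum_apply, h, Finset.sum_const,
    Finset.card_range, smul_eq_mul, nsmul_eq_mul, mul_one]
  exact ENNReal.inv_mul_cancel (by simpa using hℓ.ne') (by simp)

lemma nuU_inv (ℓ : ℕ) (μ : Measure (Ultrafilter ℕ)) (hT : MeasurePreserving sh μ μ) :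
    MeasurePreserving sh (nuU ℓ μ) (nuU ℓ μ) := by
  refine ⟨sh_cont.measurable, ?_⟩
  unfold nuU
  rw [Measure.map_smul]
  congr 1
  have h1 : Measure.map sh (∑ i ∈ Finset.range ℓ, μ.map (fun p => sh^[i] (dil ℓ p))) =
      ∑ i ∈ Finset.range ℓ, μ.map (fun p => sh^[i + 1] (dil ℓ p)) := by
    rw [← Measure.mapₗ_apply_of_measurable sh_cont.measurable, map_sum]
    refine Finset.sum_congr rfl fun i _ => ?_
    rw [Measure.mapₗ_apply_of_measurable sh_cont.measurable,
      Measure.map_map sh_cont.measurable (shdil_meas ℓ i)]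
    congr 1
    ext1 p
    simp only [Function.comp]
    rw [Function.iterate_succ_apply']
  have h2 : μ.map (fun p => sh^[ℓ] (dil ℓ p)) = μ.map (fun p => sh^[0] (dil ℓ p)) := by
    have : (fun p => sh^[ℓ] (dil ℓ p)) = dil ℓ ∘ sh := by
      ext1 p; simp only [Function.comp]; rw [dil_sh]
    rw [this, ← Measure.map_map (dil_cont ℓ).measurable sh_cont.measurable, hT.map_eq]
    rfl
  rw [h1]
  rcases Nat.eq_zero_or_pos ℓ with rfl | h0
  · simp
  obtain ⟨k, rfl⟩ : ∃ k, ℓ = k + 1 := ⟨ℓ - 1, by omega⟩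
  rw [Finset.sum_range_succ, h2, Finset.sum_range_succ' (fun i => μ.map fun p => sh^[i] (dil (k + 1) p))]

lemma nuU_le {ℓ : ℕ} (hℓ : 0 < ℓ) (μ : Measure (Ultrafilter ℕ)) :
    μ.map (dil ℓ) ≤ (ℓ : ENNReal) • nuU ℓ μ := by
  unfold nuU
  rw [smul_smul, ENNReal.mul_inv_cancel (by simpa using hℓ.ne') (by simp), one_smul]
  exact Finset.single_le_sum (f := fun i => μ.map (fun p => sh^[i] (dil ℓ p)))
    (fun i _ => Measure.zero_le _) (Finset.mem_range.2 hℓ)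

/-- the system on ultrafilters -/
noncomputable def sysU (ℓ m : ℕ) (hℓ : 0 < ℓ) (μ : Measure (Ultrafilter ℕ)) 
    (hμ : IsProbabilityMeasure μ) (hT : MeasurePreserving sh μ μ) : Sys ℓ m (Ultrafilter ℕ) where
  μ := μ
  ν := nuU ℓ μ
  hμ := hμ
  hν := nuU_prob hℓ μ
  T := sh
  φ := dil ℓ
  hTμ := hT
  hTν := nuU_inv ℓ μ hT
  hφ := (dil_cont ℓ).measurable
  hφT := dil_sh ℓ
  hle := nuU_le hℓ μ
  z := zU
  hz := fun χ => (zU_cont χ).measurable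
  hzT := zU_sh

/-- hat -/
def hat (S : Set ℕ) : Set (Ultrafilter ℕ) := {p | S ∈ p}

lemma hat_clopen (S : Set ℕ) : IsClopen (hat S) :=
  ⟨ultrafilter_isClosed_basic S, ultrafilter_isOpen_basic S⟩

lemma hat_meas (S : Set ℕ) : MeasurableSet (hat S) := (hat_clopen S).isOpen.measurableSet

/-- indicator -/
noncomputable def ind (S : Set ℕ) (n : ℕ) : ℝ := S.indicator (fun _ => (1 : ℝ)) n

/-- extended indicator -/
noncomputable def hind (S : Set ℕ) (p : Ultrafilter ℕ) : ℝ := (hat S).indicator (fun _ => (1 : ℝ)) p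

lemma hind_cont (S : Set ℕ) : Continuous (hind S) := 
  (hat_clopen S).continuous_indicator continuous_const

lemma hind_pure (S : Set ℕ) (n : ℕ) : hind S (pure n) = ind S n := by
  unfold hind ind hat
  by_cases h : n ∈ S
  · rw [Set.indicator_of_mem h, Set.indicator_of_mem]; exact h
  · rw [Set.indicator_of_notMem h, Set.indicator_of_notMem]; exact h

lemma ind_nonneg (S : Set ℕ) (n : ℕ) : 0 ≤ ind S n := Set.indicator_nonneg (fun _ _ => zero_le_one) _
lemma ind_le (S : Set ℕ) (n : ℕ) : ind S n ≤ 1 :=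
  Set.indicator_le_self' (f := fun _ => (1 : ℝ)) (fun _ _ => zero_le_one) _
lemma hind_nonneg (S : Set ℕ) (n) : 0 ≤ hind S n := Set.indicator_nonneg (fun _ _ => zero_le_one) _
lemma hind_le (S : Set ℕ) (n) : hind S n ≤ 1 :=
  Set.indicator_le_self' (f := fun _ => (1 : ℝ)) (fun _ _ => zero_le_one) _

lemma hind_map (S : Set ℕ) (k : ℕ → ℕ) (p : Ultrafilter ℕ) :
    hind S (p.map k) = hind (k ⁻¹' S) p := rfl

lemma hind_shdil (S : Set ℕ) (ℓ j : ℕ) (p : Ultrafilter ℕ) :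
    hind S (sh^[j] (dil ℓ p)) = hind {x | ℓ * x + j ∈ S} p := by
  rw [sh_iter, dil, Ultrafilter.map_map, hind_map]
  rfl

/-- averaging property -/
def IsMean (u : Ultrafilter ℕ) (μ : Measure (Ultrafilter ℕ)) : Prop :=
  ∀ g : C(Ultrafilter ℕ, ℝ), Tendsto (fun M : ℕ => (M : ℝ)⁻¹ * ∑ n ∈ Finset.range M, g (pure n))
        u (𝓝 (∫ p, g p ∂μ))

lemma mean_hat {u : Ultrafilter ℕ} {μ : Measure (Ultrafilter ℕ)} [IsProbabilityMeasure μ]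
    (h : IsMean u μ) (S : Set ℕ) :
    Tendsto (fun M : ℕ => (M : ℝ)⁻¹ * ∑ n ∈ Finset.range M, ind S n) u (𝓝 (μ.real (hat S))) := by
  have h1 := h ⟨hind S, hind_cont S⟩
  simp only [ContinuousMap.coe_mk, hind_pure] at h1
  have h2 : ∫ p, hind S p ∂μ = μ.real (hat S) := by
    unfold hind
    rw [integral_indicator (hat_meas S)]; simp
  rwa [h2] at h1

lemma mean_fc {u : Ultrafilter ℕ} {ℓ m : ℕ} (hℓ : 0 < ℓ) {μ : Measure (Ultrafilter ℕ)} 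
    [hμ : IsProbabilityMeasure μ] (hT : MeasurePreserving sh μ μ)
    (h : IsMean u μ) (S : Set ℕ) (χ : Circle) :
    Tendsto (fun M : ℕ => (M : ℂ)⁻¹ * ∑ n ∈ Finset.range M, (ind S n : ℂ) * (χ : ℂ) ^ n) u
      (𝓝 ((sysU ℓ m hℓ μ hμ hT).fc (hat S) χ)) := by
  have h1 := mean_complex u μ h (fun p => (hind S p : ℂ) * (zU p χ : ℂ))
    ((Complex.continuous_ofReal.comp (hind_cont S)).mul (Sys.circ_cont.comp (zU_cont χ)))
  simp only [hind_pure, zU_pure, Circle.coe_pow] at h1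
  convert h1 using 2
  unfold Sys.fc
  rw [← integral_indicator (hat_meas S)]
  refine integral_congr_ae (Eventually.of_forall fun p => ?_)
  simp only [Set.indicator, hind]
  split_ifs <;> simp [sysU]

lemma mean_beta {u : Ultrafilter ℕ} {ℓ m : ℕ} (hℓ : 0 < ℓ) {μ : Measure (Ultrafilter ℕ)} 
    [hμ : IsProbabilityMeasure μ] (hT : MeasurePreserving sh μ μ)
    (h : IsMean u μ) (R : Finset Circle) (S : Set ℕ) :
    Tendsto (fun M : ℕ => (ℓ : ℂ)⁻¹ * ∑ s ∈ Finset.range ℓ, (M : ℂ)⁻¹ * ∑ x ∈ Finset.range M,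
      (∑ w ∈ R, ((w ^ s * (w ^ x)⁻¹ : Circle) : ℂ)) * (ind S (ℓ * x + m * s) : ℂ)) u
      (𝓝 ((sysU ℓ m hℓ μ hμ hT).beta R (hind S))) := by
  unfold Sys.beta
  refine Tendsto.const_mul _ (tendsto_finsetSum _ fun s _ => ?_)
  have h1 := mean_complex u μ h (fun p => (∑ w ∈ R, ((w ^ s * (zU p w)⁻¹ : Circle) : ℂ)) *
    (hind {x | ℓ * x + m * s ∈ S} p : ℂ)) ((continuous_finsetSum _ fun w _ => 
      Sys.circ_cont.comp ((zU_cont w).inv.const_smul (w ^ s))).mul 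
      (Complex.continuous_ofReal.comp (hind_cont _)))
  simp only [hind_pure, zU_pure] at h1
  have h2 : ∀ p, (sysU ℓ m hℓ μ hμ hT).rw' R s p * 
      (hind S ((sysU ℓ m hℓ μ hμ hT).T^[m * s] ((sysU ℓ m hℓ μ hμ hT).φ p)) : ℂ) =
      (∑ w ∈ R, ((w ^ s * (zU p w)⁻¹ : Circle) : ℂ)) * (hind {x | ℓ * x + m * s ∈ S} p : ℂ) := by
    intro p
    rw [← hind_shdil]
    rfl
  simp only [h2]
  exact h1

end SumsetAux

namespace SumsetAux

lemma roots (q : ℕ) (hq : 0 < q) : ∃ R : Finset Circle, (∀ w, w ∈ R ↔ w ^ q = 1) ∧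
    ∀ s x : ℕ, s < q → ∑ w ∈ R, ((w ^ s * (w ^ x)⁻¹ : Circle) : ℂ) = if x % q = s then (q : ℂ) else 0 := by
  classical
  have hq0 : q ≠ 0 := hq.ne'
  let ζ : Circle := Circle.exp (2 * Real.pi / q)
  have hζc : (ζ : ℂ) = Complex.exp (2 * Real.pi * Complex.I / q) := by
    simp only [ζ, Circle.coe_exp]
    congr 1; push_cast; ring
  have hζC : IsPrimitiveRoot (ζ : ℂ) q := by rw [hζc]; exact Complex.isPrimitiveRoot_exp q hq0
  have hζ : IsPrimitiveRoot ζ q := 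
    IsPrimitiveRoot.of_map_of_injective (f := Circle.coeHom) hζC Circle.coe_injective
  have hR : ∀ w, w ∈ (Finset.range q).image (fun j => ζ ^ j) ↔ w ^ q = 1 := by
    intro w
    simp only [Finset.mem_image, Finset.mem_range]
    constructor
    · rintro ⟨j, -, rfl⟩
      rw [← pow_mul, mul_comm, pow_mul, hζ.pow_eq_one, one_pow]
    · intro h
      have : NeZero q := ⟨hq0⟩
      obtain ⟨i, hi, h2⟩ := hζC.eq_pow_of_pow_eq_one (ξ := (w : ℂ)) (by
        rw [← Circle.coe_pow, h, Circle.coe_one])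
      exact ⟨i, hi, Circle.coe_injective (by simpa using h2)⟩
  refine ⟨(Finset.range q).image (fun j => ζ ^ j), hR, fun s x hs => ?_⟩
  have hcard : ((Finset.range q).image (fun j => ζ ^ j)).card = q := by
    rw [Finset.card_image_of_injOn, Finset.card_range]
    intro i hi j hj hij
    exact hζ.pow_inj (by simpa using hi) (by simpa using hj) hij
  generalize (Finset.range q).image (fun j => ζ ^ j) = R at *
  have hxm : ∀ w ∈ R, w ^ x = w ^ (x % q) := by
    intro w hw
    conv_lhs => rw [← Nat.mod_add_div x q, pow_add, pow_mul, (hR w).1 hw, one_pow, mul_one]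
  split_ifs with h
  · rw [Finset.sum_congr rfl (g := fun _ => (1 : ℂ))]
    · simp [hcard]
    · intro w hw
      rw [hxm w hw, h, mul_inv_cancel, Circle.coe_one]
  · set S := ∑ w ∈ R, ((w ^ s * (w ^ x)⁻¹ : Circle) : ℂ) with hS
    have hζR : ζ ∈ R := (hR ζ).2 hζ.pow_eq_one
    have h1 : S = ((ζ ^ s * (ζ ^ x)⁻¹ : Circle) : ℂ) * S := by
      rw [hS, Finset.mul_sum]
      symm
      refine Finset.sum_bij (fun w _ => ζ * w) ?_ ?_ ?_ ?_
      · intro w hw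
        rw [hR] at hw ⊢
        rw [mul_pow, hw, hζ.pow_eq_one, one_mul]
      · intro a _ b _ hab
        exact mul_left_cancel hab
      · intro b hb
        refine ⟨ζ⁻¹ * b, ?_, by simp⟩
        rw [hR] at hb ⊢
        rw [mul_pow, hb, inv_pow, hζ.pow_eq_one, inv_one, one_mul]
      · intro w _
        rw [← Circle.coe_mul]
        congr 1
        rw [mul_pow, mul_pow, mul_inv]
        exact mul_mul_mul_comm _ _ _ _
    have h2 : ζ ^ s * (ζ ^ x)⁻¹ ≠ 1 := by
      intro h3
      rw [mul_inv_eq_one, hxm ζ hζR] at h3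
      exact h (hζ.pow_inj hs (Nat.mod_lt _ hq) h3).symm
    have h3 : ((ζ ^ s * (ζ ^ x)⁻¹ : Circle) : ℂ) - 1 ≠ 0 := by
      rw [sub_ne_zero]
      intro h4
      exact h2 (Circle.coe_injective (by simpa using h4))
    have h4 : (((ζ ^ s * (ζ ^ x)⁻¹ : Circle) : ℂ) - 1) * S = 0 := by
      rw [sub_mul, one_mul, ← h1, sub_self]
    exact (mul_eq_zero.1 h4).resolve_left h3

/-- real form of beta limit -/
lemma mean_beta_re {u : Ultrafilter ℕ} {ℓ m : ℕ} (hℓ : 0 < ℓ) {μ : Measure (Ultrafilter ℕ)} 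
    [hμ : IsProbabilityMeasure μ] (hT : MeasurePreserving sh μ μ)
    (h : IsMean u μ) (R : Finset Circle) 
    (hR : ∀ s x : ℕ, s < ℓ + m → ∑ w ∈ R, ((w ^ s * (w ^ x)⁻¹ : Circle) : ℂ) =
      if x % (ℓ + m) = s then ((ℓ + m : ℕ) : ℂ) else 0) (S : Set ℕ) :
    Tendsto (fun M : ℕ => (ℓ : ℝ)⁻¹ * ∑ s ∈ Finset.range ℓ, (M : ℝ)⁻¹ * ∑ x ∈ Finset.range M,
      (if x % (ℓ + m) = s then ((ℓ + m : ℕ) : ℝ) else 0) * ind S (ℓ * x + m * s)) u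
      (𝓝 ((sysU ℓ m hℓ μ hμ hT).beta R (hind S)).re) := by
  have h1 := (Complex.continuous_re.tendsto _).comp (mean_beta (m := m) hℓ hT h R S)
  refine h1.congr fun M => ?_
  simp only [Function.comp]
  rw [← Complex.ofReal_re ((ℓ : ℝ)⁻¹ * _)]
  congr 1
  simp only [Complex.ofReal_mul, Complex.ofReal_sum, Complex.ofReal_inv, Complex.ofReal_natCast]
  congr 1
  refine Finset.sum_congr rfl fun s hs => ?_
  congr 1
  refine Finset.sum_congr rfl fun x _ => ?_
  rw [hR s x (by have := Finset.mem_range.1 hs; omega)]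
  split_ifs <;> simp

/-- lower bound for the sum of the beta averages -/
lemma beta_count {ℓ m : ℕ} (hℓ : 0 < ℓ) (A : Set ℕ) (M : ℕ) (hM : 0 < M) :
    ((ℓ + m : ℕ) : ℝ) * (ℓ : ℝ)⁻¹ * (M : ℝ)⁻¹ * ∑ a ∈ Finset.range ((ℓ + m) * (ℓ * (M / (ℓ + m)))), ind A a ≤
    ∑ t ∈ Finset.range (ℓ + m), (ℓ : ℝ)⁻¹ * ∑ s ∈ Finset.range ℓ, (M : ℝ)⁻¹ * ∑ x ∈ Finset.range M,
      (if x % (ℓ + m) = s then ((ℓ + m : ℕ) : ℝ) else 0) * ind {n | n + t ∈ A} (ℓ * x + m * s) := by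
  rw [Sys.sum_range_mul_split, Finset.mul_sum]
  refine Finset.sum_le_sum fun t _ => ?_
  rw [Sys.sum_range_mul_split]
  have e : ((ℓ + m : ℕ) : ℝ) * (ℓ : ℝ)⁻¹ * (M : ℝ)⁻¹ * ∑ s ∈ Finset.range ℓ, ∑ n ∈ Finset.range (M / (ℓ + m)),
      ind A ((ℓ + m) * (ℓ * n + s) + t) = (ℓ : ℝ)⁻¹ * ∑ s ∈ Finset.range ℓ, (M : ℝ)⁻¹ *
      ∑ n ∈ Finset.range (M / (ℓ + m)), ((ℓ + m : ℕ) : ℝ) * ind A ((ℓ + m) * (ℓ * n + s) + t) := by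
    simp only [← Finset.mul_sum]
    ring
  rw [e]
  gcongr with s hs
  have hs' : s < ℓ := Finset.mem_range.1 hs
  set F : ℕ → ℝ := fun x => (if x % (ℓ + m) = s then ((ℓ + m : ℕ) : ℝ) else 0) *
    ind {n | n + t ∈ A} (ℓ * x + m * s) with hF
  have hF0 : ∀ a, 0 ≤ F a := fun a => by
    simp only [hF]
    exact mul_nonneg (by split_ifs <;> positivity) (ind_nonneg _ _)
  have h1 : ∀ n, ((ℓ + m : ℕ) : ℝ) * ind A ((ℓ + m) * (ℓ * n + s) + t) = F ((ℓ + m) * n + s) := by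
    intro n
    have h2 : ((ℓ + m) * n + s) % (ℓ + m) = s := by
      rw [Nat.mul_add_mod]; exact Nat.mod_eq_of_lt (by omega)
    have h3 : (ℓ + m) * (ℓ * n + s) + t = ℓ * ((ℓ + m) * n + s) + m * s + t := by ring
    simp only [hF, h2, if_true, h3]
    rfl
  calc ∑ n ∈ Finset.range (M / (ℓ + m)), ((ℓ + m : ℕ) : ℝ) * ind A ((ℓ + m) * (ℓ * n + s) + t)
      = ∑ n ∈ Finset.range (M / (ℓ + m)), F ((ℓ + m) * n + s) := Finset.sum_congr rfl fun n _ => h1 n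
    _ ≤ ∑ n ∈ Finset.range ((ℓ + m) * (M / (ℓ + m))), F n :=
        Sys.sum_arith_le (ℓ + m) s (by omega) F hF0 _
    _ ≤ ∑ x ∈ Finset.range M, F x := Finset.sum_le_sum_of_subset_of_nonneg
        (Finset.range_mono (Nat.mul_div_le _ _)) fun _ _ _ => hF0 _

end SumsetAux

namespace SumsetAux

open scoped Classical in
/-- counting -/
noncomputable def cn (A : Set ℕ) (N : ℕ) : ℝ := ∑ a ∈ Finset.range N, ind A a

open scoped Classical in
lemma card_cn (A : Set ℕ) (N : ℕ) :
    (((Finset.Icc 1 N).filter (· ∈ A)).card : ℝ) = ∑ a ∈ Finset.Icc 1 N, ind A a := by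
  rw [Finset.card_filter]
  push_cast
  refine Finset.sum_congr rfl fun a _ => ?_
  simp only [ind, Set.indicator]

lemma cn_mono (A : Set ℕ) : Monotone (cn A) := fun _ _ h =>
  Finset.sum_le_sum_of_subset_of_nonneg (Finset.range_mono h) fun _ _ _ => ind_nonneg _ _

open scoped Classical in
lemma card_le_cn (A : Set ℕ) (N : ℕ) :
    (((Finset.Icc 1 N).filter (· ∈ A)).card : ℝ) ≤ cn A (N + 1) := by
  rw [card_cn]
  refine Finset.sum_le_sum_of_subset_of_nonneg ?_ fun _ _ _ => ind_nonneg _ _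
  intro a; simp only [Finset.mem_Icc, Finset.mem_range]; omega

open scoped Classical in
lemma card_le_N (A : Set ℕ) (N : ℕ) :
    (((Finset.Icc 1 N).filter (· ∈ A)).card : ℝ) ≤ N := by
  have := Finset.card_filter_le (Finset.Icc 1 N) (· ∈ A)
  rw [Nat.card_Icc] at this
  exact_mod_cast this

lemma upper_freq (A : Set ℕ) (q : ℕ) (hq : 0 < q) (c : ℝ) (hc : c < upperDensity A) :
    ∃ᶠ M : ℕ in atTop, c * (q * M) - q ≤ cn A (q * M) := by
  classical
  have h := frequently_lt_of_lt_limsup (f := atTop) (hu := ⟨0, fun a ha => by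
    obtain ⟨N, hN⟩ := (Filter.eventually_map.1 ha).exists
    exact le_trans (by positivity) hN⟩) hc
  have ht : Tendsto (fun N : ℕ => N / q + 1) atTop atTop :=
    (tendsto_add_atTop_nat 1).comp (Nat.tendsto_div_const_atTop hq.ne')
  refine ht.frequently ((h.and_eventually (eventually_gt_atTop 0)).mono ?_)
  rintro N ⟨h1, hN⟩
  have hN' : (0 : ℝ) < N := by exact_mod_cast hN
  rw [lt_div_iff₀ hN'] at h1
  have hc1 : c ≤ 1 := by
    have := card_le_N A N
    by_contra hh
    push Not at hh
    nlinarith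
  have e1 : N + 1 ≤ q * (N / q + 1) := by
    have := Nat.div_add_mod N q; have := Nat.mod_lt N hq; rw [mul_add]; omega
  have e2 : q * (N / q + 1) ≤ N + q := by
    have := Nat.mul_div_le N q; rw [mul_add]; omega
  have h2 : cn A (N + 1) ≤ cn A (q * (N / q + 1)) := cn_mono A e1
  have h3 := card_le_cn A N
  have e1' : (N : ℝ) + 1 ≤ q * ((N / q + 1 : ℕ) : ℝ) := by exact_mod_cast e1
  have e2' : (q : ℝ) * ((N / q + 1 : ℕ) : ℝ) ≤ N + q := by exact_mod_cast e2
  nlinarith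

lemma lower_ev (A : Set ℕ) (c : ℝ) (hc : c < lowerDensity A) :
    ∀ᶠ N : ℕ in atTop, c * N - 1 ≤ cn A N := by
  classical
  have h := eventually_lt_of_lt_liminf (f := atTop) (hu := ⟨0, Filter.eventually_map.2 
    (Eventually.of_forall fun N => by positivity)⟩) hc
  filter_upwards [h, eventually_gt_atTop 0] with N h1 hN
  have hN' : (0 : ℝ) < N := by exact_mod_cast hN
  rw [lt_div_iff₀ hN'] at h1
  have h3 := card_le_cn A N
  have h4 : cn A (N + 1) ≤ cn A N + 1 := by
    unfold cn; rw [Finset.sum_range_succ]; linarith [ind_le A N]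
  linarith

lemma ind_comp (A : Set ℕ) (q t n : ℕ) : ind A (q * n + t) = ind {x | q * x + t ∈ A} n := rfl

lemma exists_data (ℓ m : ℕ) (hℓ : 0 < ℓ) (hm : 0 < m)
    (A : Set ℕ) (hA : lowerDensity A + upperDensity A > 1) :
    ∃ (u : Ultrafilter ℕ) (_ : (u : Filter ℕ) ≤ atTop) (μ : Measure (Ultrafilter ℕ)) 
      (hμ : IsProbabilityMeasure μ)
      (hT : MeasurePreserving sh μ μ) (_ : IsMean u μ) (R : Finset Circle) 
      (_ : ∀ w, w ∈ R ↔ w ^ (ℓ + m) = 1) (t : ℕ), t < ℓ + m ∧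
      1 < μ.real (hat {n | (ℓ + m) * n + t ∈ A}) + 
        ((sysU ℓ m hℓ μ hμ hT).beta R (hind {n | n + t ∈ A})).re := by
  set q := ℓ + m with hqd
  have hq : 0 < q := by omega
  have hqR : (0 : ℝ) < q := by exact_mod_cast hq
  have hℓR : (0 : ℝ) < ℓ := by exact_mod_cast hℓ
  set e := lowerDensity A + upperDensity A - 1 with he
  have he0 : 0 < e := by linarith
  set c1 := upperDensity A - e / 4 with hc1
  set c2 := lowerDensity A - e / 4 with hc2
  have hc : 1 < c1 + c2 := by rw [hc1, hc2]; linarith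
  have hF := upper_freq A q hq c1 (by linarith)
  have hL := lower_ev A c2 (by linarith)
  have : (atTop ⊓ 𝓟 {M : ℕ | c1 * (q * M) - q ≤ cn A (q * M)}).NeBot := 
    frequently_mem_iff_neBot.1 hF
  let u : Ultrafilter ℕ := Ultrafilter.of (atTop ⊓ 𝓟 {M : ℕ | c1 * (q * M) - q ≤ cn A (q * M)})
  have hu0 := Ultrafilter.of_le (atTop ⊓ 𝓟 {M : ℕ | c1 * (q * M) - q ≤ cn A (q * M)})
  have hu : (u : Filter ℕ) ≤ atTop := hu0.trans inf_le_left
  have huS : ∀ᶠ M : ℕ in u, c1 * (q * M) - q ≤ cn A (q * M) := 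
    le_principal_iff.1 (hu0.trans inf_le_right)
  obtain ⟨μ, hreg, hμ, hmean⟩ := exists_mean u hu
  have hT := sh_inv u hu μ hmean
  obtain ⟨R, hR1, hR2⟩ := roots q hq
  have hinv : Tendsto (fun M : ℕ => (M : ℝ)⁻¹) u (𝓝 0) := 
    (tendsto_inv_atTop_zero.comp tendsto_natCast_atTop_atTop).mono_left hu
  -- alpha
  have ha : q * c1 ≤ ∑ t ∈ Finset.range q, μ.real (hat {n | q * n + t ∈ A}) := by
    have h1 : Tendsto (fun M : ℕ => ∑ t ∈ Finset.range q, (M : ℝ)⁻¹ * 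
        ∑ n ∈ Finset.range M, ind {n | q * n + t ∈ A} n) u
        (𝓝 (∑ t ∈ Finset.range q, μ.real (hat {n | q * n + t ∈ A}))) :=
      tendsto_finsetSum _ fun t _ => mean_hat hmean _
    have h2 : Tendsto (fun M : ℕ => q * c1 - q * (M : ℝ)⁻¹) u (𝓝 (q * c1 - q * 0)) :=
      tendsto_const_nhds.sub (hinv.const_mul _)
    rw [mul_zero, sub_zero] at h2
    refine le_of_tendsto_of_tendsto h2 h1 ?_
    filter_upwards [huS, hu (eventually_gt_atTop 0)] with M hM hM0
    have hM0' : (0 : ℝ) < M := by exact_mod_cast hM0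
    rw [← Finset.mul_sum]
    simp only [← ind_comp]
    rw [← Sys.sum_range_mul_split]
    calc q * c1 - q * (M : ℝ)⁻¹ = (M : ℝ)⁻¹ * (c1 * (q * M) - q) := by field_simp
      _ ≤ _ := mul_le_mul_of_nonneg_left hM (by positivity)
  have hb : q * c2 ≤ ∑ t ∈ Finset.range q, 
      ((sysU ℓ m hℓ μ hμ hT).beta R (hind {n | n + t ∈ A})).re := by
    have h1 := tendsto_finsetSum (Finset.range q) 
      fun t _ => mean_beta_re (m := m) hℓ hT hmean R hR2 {n | n + t ∈ A}
    set K : ℝ := q * (ℓ : ℝ)⁻¹ * (ℓ * |c2| * q + 1) with hK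
    have h2 : Tendsto (fun M : ℕ => q * c2 - K * (M : ℝ)⁻¹) u (𝓝 (q * c2 - K * 0)) :=
      tendsto_const_nhds.sub (hinv.const_mul _)
    rw [mul_zero, sub_zero] at h2
    refine le_of_tendsto_of_tendsto h2 h1 ?_
    have ht : Tendsto (fun M : ℕ => q * (ℓ * (M / q))) atTop atTop := 
      (Tendsto.const_mul_atTop' hℓ (Nat.tendsto_div_const_atTop hq.ne')).const_mul_atTop' hq
    filter_upwards [hu (ht.eventually hL), hu (eventually_gt_atTop 0)] with M hM hM0
    have hM0' : (0 : ℝ) < M := by exact_mod_cast hM0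
    refine le_trans ?_ (beta_count hℓ A M hM0)
    change _ ≤ (q : ℝ) * (ℓ : ℝ)⁻¹ * (M : ℝ)⁻¹ * cn A (q * (ℓ * (M / q)))
    refine le_trans ?_ (mul_le_mul_of_nonneg_left hM (by positivity))
    have e1 : ((q * (ℓ * (M / q)) : ℕ) : ℝ) = ℓ * ((q * (M / q) : ℕ) : ℝ) := by push_cast; ring
    have e2 : ((q * (M / q) : ℕ) : ℝ) ≤ M := by exact_mod_cast Nat.mul_div_le M q
    have e3 : (M : ℝ) ≤ ((q * (M / q) : ℕ) : ℝ) + q := by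
      have := Nat.div_add_mod M q; have := Nat.mod_lt M hq
      exact_mod_cast (by omega : M ≤ q * (M / q) + q)
    rw [e1]
    generalize ((q * (M / q) : ℕ) : ℝ) = V at e2 e3
    have e4 : c2 * M - |c2| * q ≤ c2 * V := by
      have := le_abs_self c2
      have h0 := abs_nonneg c2
      have h5 : c2 * (M - V) ≤ |c2| * (M - V) := mul_le_mul_of_nonneg_right this (by linarith)
      have h6 : |c2| * (M - V) ≤ |c2| * q := mul_le_mul_of_nonneg_left (by linarith) h0
      linarith
    calc q * c2 - K * (M : ℝ)⁻¹ = q * (ℓ : ℝ)⁻¹ * (M : ℝ)⁻¹ * (ℓ * (c2 * M - |c2| * q) - 1) := by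
          rw [hK]; field_simp; ring
      _ ≤ q * (ℓ : ℝ)⁻¹ * (M : ℝ)⁻¹ * (ℓ * (c2 * V) - 1) := by gcongr
      _ = _ := by ring
  have hs : ∑ t ∈ Finset.range q, (1 : ℝ) < ∑ t ∈ Finset.range q, 
      (μ.real (hat {n | q * n + t ∈ A}) + 
        ((sysU ℓ m hℓ μ hμ hT).beta R (hind {n | n + t ∈ A})).re) := by
    rw [Finset.sum_add_distrib]
    simp only [Finset.sum_const, Finset.card_range, nsmul_eq_mul, mul_one]
    nlinarith
  obtain ⟨t, ht, h⟩ := Finset.exists_lt_of_sum_lt hs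
  exact ⟨u, hu, μ, hμ, hT, hmean, R, hR1, t, Finset.mem_range.1 ht, h⟩

end SumsetAux

namespace SumsetAux

lemma greedy {ℓ m t : ℕ} {A : Set ℕ} (L : Set ℕ)
    (H : ∀ F : Finset ℕ, (∀ n ∈ F, n ∈ L) → 
      {x | (ℓ + m) * x + t ∈ A ∧ x ∈ L ∧ ∀ n ∈ F, m * n + ℓ * x + t ∈ A}.Infinite) :
    ∃ B : Set ℕ, B.Infinite ∧ ∀ b₁ ∈ B, ∀ b₂ ∈ B, b₁ ≤ b₂ → m * b₁ + ℓ * b₂ + t ∈ A := by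
  obtain ⟨f, hf, hr⟩ := exists_seq_of_forall_finset_exists 
    (fun x => (ℓ + m) * x + t ∈ A ∧ x ∈ L) (fun x y => x < y ∧ m * x + ℓ * y + t ∈ A) (by
      intro s hs
      obtain ⟨y, hy, hlt⟩ := (H s fun n hn => (hs n hn).2).exists_gt (s.sup id)
      exact ⟨y, ⟨hy.1, hy.2.1⟩, fun x hx => 
        ⟨lt_of_le_of_lt (Finset.le_sup (f := id) hx) hlt, hy.2.2 x hx⟩⟩)
  have hmono : StrictMono f := fun a b h => (hr a b h).1
  refine ⟨Set.range f, Set.infinite_range_of_injective hmono.injective, ?_⟩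
  rintro _ ⟨i, rfl⟩ _ ⟨j, rfl⟩ hij
  rcases (hmono.le_iff_le.1 hij).lt_or_eq with h | rfl
  · exact (hr i j h).2
  · have := (hf i).1
    rwa [show m * f i + ℓ * f i + t = (ℓ + m) * f i + t by ring]

lemma main (ℓ m : ℕ) (hℓ : 0 < ℓ) (hm : 0 < m)
    (A : Set ℕ) (hA : lowerDensity A + upperDensity A > 1) :
    ∃ B : Set ℕ, B.Infinite ∧ ∃ t : ℕ, t < ℓ + m ∧
      ∀ b₁ ∈ B, ∀ b₂ ∈ B, b₁ ≤ b₂ → m * b₁ + ℓ * b₂ + t ∈ A := by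
  obtain ⟨u, hu, μ, hμ, hT, hmean, R, hR, t, htq, hgt⟩ := exists_data ℓ m hℓ hm A hA
  let E : ℕ → Set ℕ := fun n => {x | m * n + ℓ * x + t ∈ A}
  let D : Set ℕ := {n | (ℓ + m) * n + t ∈ A}
  let Lp : Ultrafilter ℕ → Set ℕ := fun p => {n | E n ∈ p}
  by_cases H : ∃ p : Ultrafilter ℕ, D ∈ p ∧ ∀ F : Finset ℕ, (∀ n ∈ F, n ∈ Lp p) → 
      {x | (ℓ + m) * x + t ∈ A ∧ x ∈ Lp p ∧ ∀ n ∈ F, m * n + ℓ * x + t ∈ A}.Infinite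
  · obtain ⟨p, -, hp⟩ := H
    obtain ⟨B, hB, h⟩ := greedy (Lp p) hp
    exact ⟨B, hB, t, htq, h⟩
  exfalso
  push Not at H
  let G : Finset ℕ → Set ℕ := fun F => {x | x ∈ D ∧ ∀ n ∈ F, x ∈ E n}
  let X : Finset ℕ → Set (Ultrafilter ℕ) := fun F => hat (G F) ∩ {p | (G F ∩ Lp p).Finite}
  have hXm : ∀ F, MeasurableSet (X F) := by
    intro F
    refine (hat_meas _).inter ?_
    have : {p : Ultrafilter ℕ | (G F ∩ Lp p).Finite} = 
        ⋃ K : ℕ, ⋂ n : ℕ, ⋂ (_ : K < n ∧ n ∈ G F), (hat (E n))ᶜ := by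
      ext p
      simp only [Set.mem_iUnion, Set.mem_iInter, Set.mem_ofPred_eq]
      constructor
      · intro h
        obtain ⟨K, hK⟩ := h.bddAbove
        refine ⟨K, fun n hn hh => ?_⟩
        have := hK (show n ∈ G F ∩ Lp p from ⟨hn.2, hh⟩)
        omega
      · rintro ⟨K, hK⟩
        refine (Set.finite_Iic K).subset fun n hn => ?_
        by_contra hh
        exact hK n ⟨not_le.1 hh, hn.1⟩ hn.2
    rw [this]
    exact MeasurableSet.iUnion fun K => MeasurableSet.iInter fun n => MeasurableSet.iInter fun _ =>
      (hat_meas _).compl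
  have hcov : hat D ⊆ ⋃ F, X F := by
    intro p hp
    obtain ⟨F, hF, hfin⟩ := H p hp
    refine Set.mem_iUnion.2 ⟨F, ?_, ?_⟩
    · have h1 : G F = D ∩ ⋂ n ∈ F, E n := by ext x; simp [G]
      change G F ∈ p
      rw [h1]
      exact inter_mem hp ((biInter_finset_mem F).2 hF)
    · refine (Set.not_infinite.1 (by simpa using hfin)).subset ?_
      rintro x ⟨⟨h1, h2⟩, h3⟩
      exact ⟨h1, h3, h2⟩
  let en : ℕ → Finset ℕ := (Denumerable.eqv (Finset ℕ)).symm
  let W : ℕ → Set (Ultrafilter ℕ) := fun j => X (en j)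
  have hW : hat D ⊆ ⋃ j, W j := by
    intro p hp
    obtain ⟨F, hF⟩ := Set.mem_iUnion.1 (hcov hp)
    refine Set.mem_iUnion.2 ⟨Denumerable.eqv (Finset ℕ) F, ?_⟩
    simpa [W, en] using hF
  have hle : μ.real (hat D) ≤ μ.real (⋃ j, W j) := measureReal_mono hW
  have hlim : Tendsto (fun r => μ.real (partialSups W r)) atTop (𝓝 (μ.real (⋃ j, W j))) := by
    have h1 := tendsto_measure_iUnion_atTop (μ := μ) (s := partialSups W) (partialSups_monotone W)
    have h2 : ⋃ j, partialSups W j = ⋃ j, W j := iSup_partialSups_eq W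
    rw [h2] at h1
    exact (ENNReal.tendsto_toReal (measure_ne_top _ _)).comp h1
  have hlt : 1 - ((sysU ℓ m hℓ μ hμ hT).beta R (hind {n | n + t ∈ A})).re < μ.real (⋃ j, W j) := by
    have : μ.real (hat D) = μ.real (hat {n | (ℓ + m) * n + t ∈ A}) := rfl
    linarith
  obtain ⟨r, hr⟩ := (hlim.eventually (lt_mem_nhds hlt)).exists
  have hc2 := (sysU ℓ m hℓ μ hμ hT).core2 hℓ hm R hR (hind {n | n + t ∈ A}) 
    (hind_cont _).measurable (hind_nonneg _) (hind_le _) (r + 1) 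
    (fun j => disjointed W j) (fun j => hat (G (en j)))
    (fun j => MeasurableSet.disjointed (fun i => hXm _) j)
    (fun j => (disjointed_subset W j).trans Set.inter_subset_left)
    (fun i j hij => disjoint_disjointed W (fun h => hij (Fin.ext h)))
    (fun j n => ind (G (en j)) n) (fun j n => ⟨ind_nonneg _ _, ind_le _ _⟩) u hu
    (fun j χ => mean_fc hℓ hT hmean _ χ) (by
      intro j p hp
      have hp2 : (G (en j) ∩ Lp p).Finite := (disjointed_subset W j hp).2
      refine hp2.subset fun n hn => ?_
      have h1 : ind (G (en j)) n * hind {n | n + t ∈ A} (sh^[m * n] (dil ℓ p)) ≠ 0 := hn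
      rw [hind_shdil] at h1
      constructor
      · by_contra hh
        exact h1 (by rw [ind, Set.indicator_of_notMem hh, zero_mul])
      · by_contra hh
        refine h1 ?_
        rw [hind, Set.indicator_of_notMem, mul_zero]
        intro hq
        refine hh ?_
        change E n ∈ p
        have : E n = {x | ℓ * x + m * n ∈ {n | n + t ∈ A}} := by
          ext x; simp only [E, Set.mem_ofPred_eq, add_comm (m * n)]
        rw [this]; exact hq)
  have hun : (⋃ j : Fin (r + 1), disjointed W j) = partialSups W r := by
    rw [← partialSups_disjointed, partialSups_eq_biUnion_range]
    ext p
    simp only [Set.mem_iUnion, Finset.mem_range]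
    constructor
    · rintro ⟨j, hj⟩; exact ⟨j, j.2, hj⟩
    · rintro ⟨j, hj, h⟩; exact ⟨⟨j, hj⟩, h⟩
  rw [hun] at hc2
  exact absurd hr (not_lt.2 hc2)

end SumsetAux

/-- If `d_(A) + d̄(A) > 1`, there exist an infinite `B ⊆ ℕ` and `t ∈ {0, …, ℓ+m-1}` with
`{m b₁ + ℓ b₂ : b₁, b₂ ∈ B, b₁ ≤ b₂} + t ⊆ A`. -/
theorem mB_add_lB_diag_mixed_density_shifted (ℓ m : ℕ) (hℓ : 0 < ℓ) (hm : 0 < m)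
    (A : Set ℕ) (hA : lowerDensity A + upperDensity A > 1) :
    ∃ B : Set ℕ, B.Infinite ∧ ∃ t : ℕ, t < ℓ + m ∧
      ∀ b₁ ∈ B, ∀ b₂ ∈ B, b₁ ≤ b₂ → m * b₁ + ℓ * b₂ + t ∈ A := by
  exact SumsetAux.main ℓ m hℓ hm A hA
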